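/- Let k ≥ 1 be a constant integer and suppose K_n → ∞, K_n²/P_n → 0, and p_{e,q}(n) = (ln n + (k−1)·ln ln n + b·ln ln n + β_n)/n, where b is a constant integer and the real sequence β_n satisfies −1 < liminf_{n→∞} β_n/ln ln n ≤ limsup_{n→∞} β_n/ln ln n < 1. If k + b ≥ 1, then the probability that the minimum degree δ_n of 𝔾_q(n,K_n,P_n,p_n) equals k+b or k+b−1 converges to 1 as n → ∞. -/

import Mathlib

open Finset Filter

/-- A configuration of the random graph `𝔾_q(n,K,P,p)`: a key-ring assignment
(one finite subset of the key pool `Fin P` per vertex) together with the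
on/off states of the channels (one Boolean per unordered pair of vertices). -/
abbrev Config (n P : ℕ) : Type := (Fin n → Finset (Fin P)) × (Sym2 (Fin n) → Bool)

/-- Probability weight of a configuration: the key rings are independent and
uniform over the `K`-element subsets of the pool of size `P`, and the channels
are independent Bernoulli(`p`). -/
noncomputable def weight (n K P : ℕ) (p : ℝ) (ω : Config n P) : ℝ :=
  (∏ i : Fin n, if (ω.1 i).card = K then ((P.choose K : ℝ))⁻¹ else 0) *
  (∏ e : Sym2 (Fin n), if ω.2 e then p else 1 - p)

/-- Probability of an event in `𝔾_q(n,K,P,p)`. -/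
noncomputable def prob (n K P : ℕ) (p : ℝ) (E : Set (Config n P)) : ℝ :=
  ∑ ω : Config n P, Set.indicator E (weight n K P p) ω

/-- Adjacency in `𝔾_q(n,K,P,p)`: two distinct vertices are adjacent iff their
key rings share at least `q` keys and the channel between them is on. -/
def Adj (q n P : ℕ) (ω : Config n P) (i j : Fin n) : Prop :=
  i ≠ j ∧ q ≤ ((ω.1 i) ∩ (ω.1 j)).card ∧ ω.2 s(i, j) = true

/-- Degree of a vertex. -/
noncomputable def degree (q n P : ℕ) (ω : Config n P) (i : Fin n) : ℕ :=
  Nat.card {j : Fin n // Adj q n P ω i j}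

/-- Minimum degree of the graph. -/
noncomputable def minDeg (q n P : ℕ) (ω : Config n P) : ℕ :=
  sInf (Set.range fun i => degree q n P ω i)

/-- `p_{s,q}`: the probability that two key rings share at least `q` keys. -/
noncomputable def psq (q K P : ℕ) : ℝ :=
  1 - ∑ u ∈ Finset.range q,
    ((K.choose u : ℝ) * ((P - K).choose (K - u) : ℝ)) / (P.choose K : ℝ)

/-- `p_{e,q}`: the probability that two distinct vertices are adjacent. -/
noncomputable def peq (q K P : ℕ) (p : ℝ) : ℝ := p * psq q K P

/-! ### Finite product weights -/

theorem sum_prod_weight_mul_prod {V X ι : Type*} [Fintype V] [Fintype X] [Fintype ι]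
    [DecidableEq V] (r : X → ℝ) (hr : ∑ u, r u = 1) (f : ι → V) (hf : Function.Injective f)
    (g : ι → X → ℝ) :
    ∑ S : V → X, (∏ v, r (S v)) * ∏ x, g x (S (f x)) = ∏ x, ∑ u, r u * g x u := by
  classical
  have h1 : ∀ S : V → X, (∏ v, r (S v)) * ∏ x, g x (S (f x))
      = ∏ v, (r (S v) * ∏ x with f x = v, g x (S v)) := by
    intro S
    rw [Finset.prod_mul_distrib, ← Finset.prod_fiberwise univ f (fun x => g x (S (f x)))]
    congr 1
    refine Finset.prod_congr rfl fun v _ => Finset.prod_congr rfl fun x hx => ?_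
    rw [(Finset.mem_filter.1 hx).2]
  have h2 : ∏ v, ∑ u, (r u * ∏ x with f x = v, g x u)
      = ∑ S : V → X, ∏ v, (r (S v) * ∏ x with f x = v, g x (S v)) := by
    rw [Finset.prod_univ_sum, Fintype.piFinset_univ]
  rw [Finset.sum_congr rfl fun S _ => h1 S, ← h2,
    ← Finset.prod_fiberwise univ f (fun x => ∑ u, r u * g x u)]
  refine Finset.prod_congr rfl fun v _ => ?_
  by_cases hv : ∃ x, f x = v
  · obtain ⟨x, rfl⟩ := hv
    have : (univ.filter fun y => f y = f x) = {x} := by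
      ext y; simp [hf.eq_iff]
    simp [this]
  · have : (univ.filter fun y => f y = v) = ∅ := by
      ext y; simpa using fun h => hv ⟨y, h⟩
    simp [this, hr]

theorem sum_prod_weight {V X : Type*} [Fintype V] [Fintype X] [DecidableEq V]
    (r : X → ℝ) (hr : ∑ u, r u = 1) : ∑ S : V → X, ∏ v, r (S v) = 1 := by
  simpa using sum_prod_weight_mul_prod (ι := Empty) r hr Empty.elim (fun a => a.elim)
    (fun a => a.elim)

/-- Resampling one coordinate does not change an expectation under a product weight. -/
theorem sum_prod_weight_resample {V X : Type*} [Fintype V] [Fintype X] [DecidableEq V]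
    (r : X → ℝ) (hr : ∑ u, r u = 1) (i : V) (F : (V → X) → ℝ) :
    ∑ S : V → X, (∏ v, r (S v)) * F S
      = ∑ s, r s * ∑ S : V → X, (∏ v, r (S v)) * F (Function.update S i s) := by
  have hsum : ∀ H : (V → X) → ℝ, ∑ S, H S
      = ∑ x : X, ∑ S' : {j // j ≠ i} → X, H ((Equiv.funSplitAt i X).symm (x, S')) := by
    intro H
    rw [← (Equiv.funSplitAt i X).symm.sum_comp, Fintype.sum_prod_type]
  have hprod : ∀ (x : X) (S' : {j // j ≠ i} → X),
      ∏ v, r ((Equiv.funSplitAt i X).symm (x, S') v) = r x * ∏ v, r (S' v) := by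
    intro x S'
    rw [Fintype.prod_eq_mul_prod_subtype_ne _ i]
    congr 1
    · simp [Equiv.funSplitAt_symm_apply]
    · refine Finset.prod_congr rfl fun v _ => ?_
      simp [Equiv.funSplitAt_symm_apply, v.2]
  have hupd : ∀ (s x : X) (S' : {j // j ≠ i} → X),
      Function.update ((Equiv.funSplitAt i X).symm (x, S')) i s
        = (Equiv.funSplitAt i X).symm (s, S') := by
    intro s x S'
    ext v
    by_cases h : v = i
    · subst h; simp [Equiv.funSplitAt_symm_apply]
    · simp [Equiv.funSplitAt_symm_apply, h]
  rw [hsum]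
  refine Finset.sum_congr rfl fun s _ => ?_
  rw [hsum]
  simp_rw [hprod, hupd, mul_assoc, ← Finset.mul_sum]
  rw [← Finset.sum_mul, hr, one_mul]

/-! ### Weights of key rings and channels -/

/-- Probability weight of a key ring. -/
noncomputable def ringWeight (K P : ℕ) (s : Finset (Fin P)) : ℝ :=
  if s.card = K then ((P.choose K : ℝ))⁻¹ else 0

/-- Probability weight of a channel state. -/
noncomputable def chanWeight (p : ℝ) (b : Bool) : ℝ := if b then p else 1 - p

/-- Indicator that two key rings share at least `q` keys. -/
noncomputable def share {P : ℕ} (q : ℕ) (s t : Finset (Fin P)) : ℝ :=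
  if q ≤ (s ∩ t).card then 1 else 0

theorem chanWeight_sum (p : ℝ) : ∑ b, chanWeight p b = 1 := by
  simp [chanWeight]

theorem chanWeight_nonneg {p : ℝ} (hp : p ∈ Set.Ioc (0 : ℝ) 1) (b : Bool) :
    0 ≤ chanWeight p b := by
  have := hp.1; have := hp.2
  unfold chanWeight; split_ifs <;> linarith

theorem ringWeight_nonneg (K P : ℕ) (s : Finset (Fin P)) : 0 ≤ ringWeight K P s := by
  unfold ringWeight; split_ifs <;> positivity

theorem sum_ringWeight_mul (K P : ℕ) (f : Finset (Fin P) → ℝ) :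
    ∑ s, ringWeight K P s * f s
      = (∑ s ∈ powersetCard K (univ : Finset (Fin P)), f s) / (P.choose K : ℝ) := by
  simp only [ringWeight, ite_mul, zero_mul]
  rw [← Finset.sum_filter, div_eq_inv_mul, Finset.mul_sum]
  refine Finset.sum_congr ?_ fun _ _ => rfl
  ext s; simp [Finset.mem_powersetCard]

theorem ringWeight_sum {K P : ℕ} (h : K ≤ P) : ∑ s, ringWeight K P s = 1 := by
  have h0 : (P.choose K : ℝ) ≠ 0 := by exact_mod_cast (Nat.choose_pos h).ne'
  have := sum_ringWeight_mul K P (fun _ => 1)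
  simp only [mul_one, sum_const, card_powersetCard, card_univ, Fintype.card_fin] at this
  rw [this]; simp [h0]

theorem share_nonneg {P : ℕ} (q : ℕ) (s t : Finset (Fin P)) : 0 ≤ share q s t := by
  unfold share; split_ifs <;> norm_num

theorem share_le_one {P : ℕ} (q : ℕ) (s t : Finset (Fin P)) : share q s t ≤ 1 := by
  unfold share; split_ifs <;> norm_num

/-! ### Expectations in the random graph -/

/-- Expectation over configurations. -/
noncomputable def graphExpect (n K P : ℕ) (p : ℝ) (F : Config n P → ℝ) : ℝ :=
  ∑ ω : Config n P, weight n K P p ω * F ω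

theorem weight_eq (n K P : ℕ) (p : ℝ) (ω : Config n P) :
    weight n K P p ω = (∏ i, ringWeight K P (ω.1 i)) * ∏ e, chanWeight p (ω.2 e) := rfl

theorem weight_nonneg {n K P : ℕ} {p : ℝ} (hp : p ∈ Set.Ioc (0 : ℝ) 1) (ω : Config n P) :
    0 ≤ weight n K P p ω := by
  rw [weight_eq]
  exact mul_nonneg (prod_nonneg fun i _ => ringWeight_nonneg _ _ _)
    (prod_nonneg fun i _ => chanWeight_nonneg hp _)

theorem graphExpect_eq (n K P : ℕ) (p : ℝ) (F : Config n P → ℝ) :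
    graphExpect n K P p F = ∑ S : Fin n → Finset (Fin P), (∏ i, ringWeight K P (S i)) *
      ∑ c : Sym2 (Fin n) → Bool, (∏ e, chanWeight p (c e)) * F (S, c) := by
  unfold graphExpect
  rw [Fintype.sum_prod_type]
  simp_rw [weight_eq, Finset.mul_sum, mul_assoc]

theorem graphExpect_one {n K P : ℕ} (hKP : K ≤ P) (p : ℝ) :
    graphExpect n K P p (fun _ => 1) = 1 := by
  rw [graphExpect_eq]
  simp [sum_prod_weight _ (chanWeight_sum p), sum_prod_weight _ (ringWeight_sum hKP)]

theorem graphExpect_mono {n K P : ℕ} {p : ℝ} (hp : p ∈ Set.Ioc (0 : ℝ) 1) {F G : Config n P → ℝ}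
    (h : ∀ ω, F ω ≤ G ω) : graphExpect n K P p F ≤ graphExpect n K P p G :=
  sum_le_sum fun ω _ => mul_le_mul_of_nonneg_left (h ω) (weight_nonneg hp ω)

theorem graphExpect_sum {ι : Type*} (n K P : ℕ) (p : ℝ) (s : Finset ι) (F : ι → Config n P → ℝ) :
    graphExpect n K P p (fun ω => ∑ x ∈ s, F x ω) = ∑ x ∈ s, graphExpect n K P p (F x) := by
  unfold graphExpect
  simp_rw [Finset.mul_sum]
  exact Finset.sum_comm

theorem graphExpect_add (n K P : ℕ) (p : ℝ) (F G : Config n P → ℝ) :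
    graphExpect n K P p (fun ω => F ω + G ω) = graphExpect n K P p F + graphExpect n K P p G := by
  simp [graphExpect, mul_add, sum_add_distrib]

theorem graphExpect_const_mul (n K P : ℕ) (p a : ℝ) (F : Config n P → ℝ) :
    graphExpect n K P p (fun ω => a * F ω) = a * graphExpect n K P p F := by
  simp only [graphExpect, Finset.mul_sum]
  exact sum_congr rfl fun _ _ => by ring

theorem prob_eq_graphExpect (n K P : ℕ) (p : ℝ) (E : Set (Config n P)) :
    prob n K P p E = graphExpect n K P p (E.indicator fun _ => 1) := by
  classical
  unfold prob graphExpect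
  refine sum_congr rfl fun ω _ => ?_
  simp [Set.indicator_apply]

/-! ### Laws of neighbourhoods -/

/-- The neighbours of `i` inside `T`. -/
noncomputable def nbrIn (q n P : ℕ) (ω : Config n P) (i : Fin n) (T : Finset (Fin n)) :
    Finset (Fin n) :=
  open Classical in T.filter fun j => Adj q n P ω i j

/-- The probability that an indicator variable of mean `x` agrees with the truth value of `a`. -/
noncomputable def agree (a : Prop) (x : ℝ) : ℝ :=
  open Classical in if a then x else 1 - x

/-- Real-valued indicator of a proposition. -/
noncomputable def ind (a : Prop) : ℝ :=
  open Classical in if a then 1 else 0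

theorem ind_true {a : Prop} (h : a) : ind a = 1 := by simp [ind, h]

theorem ind_false {a : Prop} (h : ¬ a) : ind a = 0 := by simp [ind, h]

theorem ind_nonneg (a : Prop) : 0 ≤ ind a := by unfold ind; split_ifs <;> norm_num

theorem ind_mono {a b : Prop} (h : a → b) : ind a ≤ ind b := by
  by_cases ha : a
  · rw [ind_true ha, ind_true (h ha)]
  · rw [ind_false ha]; exact ind_nonneg b

theorem ind_and (a b : Prop) : ind (a ∧ b) = ind a * ind b := by
  by_cases ha : a <;> by_cases hb : b <;> simp [ind, ha, hb]

theorem agree_ind (a b : Prop) : agree a (ind b) = ind (b ↔ a) := by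
  by_cases ha : a <;> by_cases hb : b <;> simp [agree, ind, ha, hb]

theorem prod_ind {ι : Type*} [Fintype ι] (a : ι → Prop) : ∏ x, ind (a x) = ind (∀ x, a x) := by
  classical
  by_cases h : ∀ x, a x
  · rw [ind_true h]; exact prod_eq_one fun x _ => ind_true (h x)
  · rw [ind_false h]
    push Not at h
    obtain ⟨x, hx⟩ := h
    exact prod_eq_zero (mem_univ x) (ind_false hx)

theorem sum_mul_agree {X : Type*} [Fintype X] (r : X → ℝ) (hr : ∑ u, r u = 1) (a : Prop)
    (x : X → ℝ) : ∑ u, r u * agree a (x u) = agree a (∑ u, r u * x u) := by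
  unfold agree
  split_ifs
  · rfl
  · simp [mul_sub, sum_sub_distrib, hr]

theorem ind_nbrIn_eq {q n P : ℕ} (ω : Config n P) {i : Fin n} {T A : Finset (Fin n)}
    (hi : i ∉ T) (hA : A ⊆ T) :
    ind (nbrIn q n P ω i T = A)
      = ∏ l : T, agree ((l : Fin n) ∈ A)
          (share q (ω.1 i) (ω.1 l) * ind (ω.2 s(i, (l : Fin n)) = true)) := by
  have h : ∀ l : T, agree ((l : Fin n) ∈ A)
      (share q (ω.1 i) (ω.1 l) * ind (ω.2 s(i, (l : Fin n)) = true))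
        = ind (Adj q n P ω i l ↔ (l : Fin n) ∈ A) := by
    intro l
    have hne : i ≠ (l : Fin n) := fun h => hi (h ▸ l.2)
    rw [← agree_ind]
    congr 1
    unfold share ind Adj
    by_cases h1 : q ≤ (ω.1 i ∩ ω.1 l).card <;> by_cases h2 : ω.2 s(i, (l : Fin n)) = true <;>
      simp [h1, h2, hne]
  simp_rw [h]
  rw [prod_ind]
  congr 1
  refine propext ⟨?_, ?_⟩
  · rintro rfl l
    simp [nbrIn]
  · intro h
    ext l
    by_cases hl : l ∈ T
    · simpa [nbrIn, hl] using h ⟨l, hl⟩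
    · simpa [nbrIn, hl] using fun h' => hl (hA h')

theorem sum_chanWeight_mul_agree (p x : ℝ) (a : Prop) :
    ∑ b, chanWeight p b * agree a (x * ind (b = true)) = agree a (p * x) := by
  rw [sum_mul_agree _ (chanWeight_sum p)]
  congr 1
  simp [chanWeight, ind]

theorem graphExpect_nbrIn {q n K P : ℕ} (hKP : K ≤ P) (p : ℝ) {i : Fin n} {T A : Finset (Fin n)}
    (hi : i ∉ T) (hA : A ⊆ T) :
    graphExpect n K P p (fun ω => ind (nbrIn q n P ω i T = A))
      = ∑ s, ringWeight K P s *
          ∏ l : T, agree ((l : Fin n) ∈ A) (p * ∑ u, ringWeight K P u * share q s u) := by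
  classical
  have hinj : Function.Injective fun l : T => s(i, (l : Fin n)) := by
    intro l m h
    have hne : i ≠ (l : Fin n) := fun h => hi (h ▸ l.2)
    have hne' : i ≠ (m : Fin n) := fun h => hi (h ▸ m.2)
    simp only [Sym2.eq_iff] at h
    ext
    rcases h with h | h
    · rw [h.2]
    · exact absurd h.1 hne'
  rw [graphExpect_eq]
  simp_rw [ind_nbrIn_eq _ hi hA]
  have h1 : ∀ S : Fin n → Finset (Fin P), ∑ c : Sym2 (Fin n) → Bool, (∏ e, chanWeight p (c e)) *
      ∏ l : T, agree ((l : Fin n) ∈ A) (share q (S i) (S l) * ind (c s(i, (l : Fin n)) = true))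
      = ∏ l : T, agree ((l : Fin n) ∈ A) (p * share q (S i) (S l)) := by
    intro S
    rw [sum_prod_weight_mul_prod (chanWeight p) (chanWeight_sum p)
      (fun l : T => s(i, (l : Fin n))) hinj
      (fun l b => agree ((l : Fin n) ∈ A) (share q (S i) (S l) * ind (b = true)))]
    exact prod_congr rfl fun l _ => sum_chanWeight_mul_agree _ _ _
  simp_rw [h1]
  rw [sum_prod_weight_resample _ (ringWeight_sum hKP) i]
  refine sum_congr rfl fun s _ => ?_
  congr 1
  have h2 : ∀ (S : Fin n → Finset (Fin P)) (l : T), Function.update S i s l = S l := by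
    intro S l
    refine Function.update_of_ne (fun h => hi ?_) _ _
    rw [← h]; exact l.2
  simp_rw [h2, Function.update_self]
  rw [sum_prod_weight_mul_prod (ringWeight K P) (ringWeight_sum hKP)
    (fun l : T => (l : Fin n)) Subtype.val_injective
    (fun l u => agree ((l : Fin n) ∈ A) (p * share q s u))]
  refine prod_congr rfl fun l _ => ?_
  rw [sum_mul_agree _ (ringWeight_sum hKP), Finset.mul_sum]
  congr 1
  exact sum_congr rfl fun u _ => by ring

theorem graphExpect_nbrIn_pair {q n K P : ℕ} (hKP : K ≤ P) (p : ℝ) {i j : Fin n} (hij : i ≠ j)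
    {T A B : Finset (Fin n)} (hi : i ∉ T) (hj : j ∉ T) (hA : A ⊆ T) (hB : B ⊆ T)
    (Φ : Finset (Fin P) → Finset (Fin P) → ℝ) :
    graphExpect n K P p (fun ω => Φ (ω.1 i) (ω.1 j) *
        (ind (nbrIn q n P ω i T = A) * ind (nbrIn q n P ω j T = B)))
      = ∑ s, ringWeight K P s * ∑ t, ringWeight K P t * (Φ s t *
          ∏ l : T, ∑ u, ringWeight K P u *
            (agree ((l : Fin n) ∈ A) (p * share q s u) *
              agree ((l : Fin n) ∈ B) (p * share q t u))) := by
  classical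
  have hneT : ∀ {m : Fin n}, m ∉ T → ∀ l : T, m ≠ (l : Fin n) :=
    fun hm l h => hm (h ▸ l.2)
  have hinj : ∀ {m : Fin n}, m ∉ T → Function.Injective fun l : T => s(m, (l : Fin n)) := by
    intro m hm l l' h
    simp only [Sym2.eq_iff] at h
    ext
    rcases h with h | h
    · rw [h.2]
    · exact absurd h.1 (hneT hm l')
  have hinj2 : Function.Injective
      (Sum.elim (fun l : T => s(i, (l : Fin n))) (fun l : T => s(j, (l : Fin n)))) := by
    refine (hinj hi).sumElim (hinj hj) fun l l' h => ?_
    simp only [Sym2.eq_iff] at h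
    rcases h with h | h
    · exact hij h.1
    · exact hneT hi l' h.1
  rw [graphExpect_eq]
  simp_rw [ind_nbrIn_eq _ hi hA, ind_nbrIn_eq _ hj hB]
  have h1 : ∀ S : Fin n → Finset (Fin P), ∑ c : Sym2 (Fin n) → Bool, (∏ e, chanWeight p (c e)) *
      (Φ (S i) (S j) *
      ((∏ l : T, agree ((l : Fin n) ∈ A) (share q (S i) (S l) * ind (c s(i, (l : Fin n)) = true))) *
      ∏ l : T, agree ((l : Fin n) ∈ B) (share q (S j) (S l) * ind (c s(j, (l : Fin n)) = true))))
      = Φ (S i) (S j) * ∏ l : T, (agree ((l : Fin n) ∈ A) (p * share q (S i) (S l)) *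
        agree ((l : Fin n) ∈ B) (p * share q (S j) (S l))) := by
    intro S
    have := sum_prod_weight_mul_prod (chanWeight p) (chanWeight_sum p) _ hinj2
      (Sum.elim (fun l b => agree ((l : Fin n) ∈ A) (share q (S i) (S l) * ind (b = true)))
        (fun l b => agree ((l : Fin n) ∈ B) (share q (S j) (S l) * ind (b = true))))
    simp only [Fintype.prod_sum_type, Sum.elim_inl, Sum.elim_inr, sum_chanWeight_mul_agree] at this
    rw [prod_mul_distrib, ← this, Finset.mul_sum]
    exact sum_congr rfl fun c _ => by ring
  simp_rw [h1]
  rw [sum_prod_weight_resample _ (ringWeight_sum hKP) i]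
  refine sum_congr rfl fun s _ => ?_
  congr 1
  rw [sum_prod_weight_resample _ (ringWeight_sum hKP) j]
  refine sum_congr rfl fun t _ => ?_
  congr 1
  have h2 : ∀ (S : Fin n → Finset (Fin P)) (l : T),
      Function.update (Function.update S j t) i s l = S l := by
    intro S l
    rw [Function.update_of_ne (hneT hi l).symm, Function.update_of_ne (hneT hj l).symm]
  have h3 : ∀ (S : Fin n → Finset (Fin P)),
      Function.update (Function.update S j t) i s j = t := by
    intro S
    rw [Function.update_of_ne hij.symm, Function.update_self]
  simp_rw [h2, h3, Function.update_self]
  rw [← sum_prod_weight_mul_prod (ringWeight K P) (ringWeight_sum hKP)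
    (fun l : T => (l : Fin n)) Subtype.val_injective
    (fun l u => agree ((l : Fin n) ∈ A) (p * share q s u) *
      agree ((l : Fin n) ∈ B) (p * share q t u)), Finset.mul_sum]
  exact sum_congr rfl fun S _ => by ring

/-! ### Overlaps of uniform key rings -/

theorem descFactorial_mul_pow_le {d N : ℕ} (h : d ≤ N) (t : ℕ) :
    d.descFactorial t * N ^ t ≤ N.descFactorial t * d ^ t := by
  induction t with
  | zero => simp
  | succ t ih =>
    have h1 : (d - t) * N ≤ (N - t) * d := by
      rw [Nat.sub_mul, Nat.sub_mul, mul_comm d N]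
      exact Nat.sub_le_sub_left (Nat.mul_le_mul_left t h) _
    calc d.descFactorial (t + 1) * N ^ (t + 1)
        = ((d - t) * N) * (d.descFactorial t * N ^ t) := by rw [Nat.descFactorial_succ]; ring
      _ ≤ ((N - t) * d) * (N.descFactorial t * d ^ t) := Nat.mul_le_mul h1 ih
      _ = N.descFactorial (t + 1) * d ^ (t + 1) := by rw [Nat.descFactorial_succ]; ring

theorem choose_sub_sub_le {N d t : ℕ} (ht : t ≤ d) (hd : d ≤ N) (hN : 0 < N) :
    ((N - t).choose (d - t) : ℝ) ≤ N.choose d * ((d : ℝ) / N) ^ t := by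
  have h1 : N.choose d * d.choose t = N.choose t * (N - t).choose (d - t) := Nat.choose_mul ht
  have h2 : d.choose t * N ^ t ≤ N.choose t * d ^ t := by
    have := descFactorial_mul_pow_le hd t
    rw [Nat.descFactorial_eq_factorial_mul_choose, Nat.descFactorial_eq_factorial_mul_choose,
      mul_assoc, mul_assoc] at this
    exact Nat.le_of_mul_le_mul_left this (Nat.factorial_pos t)
  have h1' : (N.choose d : ℝ) * d.choose t = N.choose t * (N - t).choose (d - t) := by
    exact_mod_cast h1
  have h2' : (d.choose t : ℝ) * N ^ t ≤ N.choose t * d ^ t := by exact_mod_cast h2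
  have h3 : (0 : ℝ) < N.choose t := by exact_mod_cast Nat.choose_pos (ht.trans hd)
  have h4 : (0 : ℝ) < (N : ℝ) ^ t := by positivity
  rw [div_pow, ← mul_div_assoc, le_div_iff₀ h4]
  refine le_of_mul_le_mul_left ?_ h3
  calc (N.choose t : ℝ) * ((N - t).choose (d - t) * N ^ t)
      = N.choose d * (d.choose t * N ^ t) := by rw [← mul_assoc, ← h1']; ring
    _ ≤ N.choose d * (N.choose t * d ^ t) := by gcongr
    _ = _ := by ring

theorem card_powersetCard_superset_le {α : Type*} [DecidableEq α] {U I : Finset α} {d : ℕ}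
    (hI : I ⊆ U) (hd : d ≤ U.card) (hU : 0 < U.card) :
    (((powersetCard d U).filter fun B => I ⊆ B).card : ℝ)
      ≤ U.card.choose d * ((d : ℝ) / U.card) ^ I.card := by
  by_cases hId : I.card ≤ d
  · refine le_trans ?_ (choose_sub_sub_le hId hd hU)
    rw [← card_sdiff_of_subset hI, ← card_powersetCard]
    norm_cast
    refine card_le_card_of_injOn (fun B => B \ I) ?_ ?_
    · intro B hB
      simp only [coe_filter, mem_powersetCard, Set.mem_ofPred_eq] at hB
      simp only [mem_coe, mem_powersetCard]
      exact ⟨sdiff_subset_sdiff hB.1.1 subset_rfl, by rw [card_sdiff_of_subset hB.2, hB.1.2]⟩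
    · intro B hB B' hB' h
      simp only [coe_filter, mem_powersetCard, Set.mem_ofPred_eq] at hB hB'
      have h' : B \ I = B' \ I := h
      rw [← sdiff_union_of_subset hB.2, ← sdiff_union_of_subset hB'.2, h']
  · have : ((powersetCard d U).filter fun B => I ⊆ B) = ∅ := by
      refine filter_eq_empty_iff.2 fun B hB h => hId ?_
      rw [← (mem_powersetCard.1 hB).2]
      exact card_le_card h
    rw [this]
    simp only [card_empty, Nat.cast_zero]
    positivity

theorem card_inter_eq {P K j : ℕ} {s : Finset (Fin P)} (hs : s.card = K) (hj : j ≤ K) :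
    ((powersetCard K (univ : Finset (Fin P))).filter fun u => (s ∩ u).card = j).card
      = K.choose j * (P - K).choose (K - j) := by
  have hc : sᶜ.card = P - K := by rw [card_compl, Fintype.card_fin, hs]
  rw [← hc, ← hs, ← card_powersetCard, hs, ← card_powersetCard, ← card_product]
  have hdisj : ∀ {a b : Finset (Fin P)}, a ⊆ s → b ⊆ sᶜ → Disjoint a b := fun ha hb =>
    disjoint_left.2 fun x hx hx' => mem_compl.1 (hb hx') (ha hx)
  refine card_nbij' (fun u => (s ∩ u, u \ s)) (fun x => x.1 ∪ x.2) ?_ ?_ ?_ ?_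
  · intro u hu
    simp only [coe_filter, mem_powersetCard, subset_univ, true_and, Set.mem_ofPred_eq] at hu
    simp only [coe_product, Set.mem_prod, mem_coe, mem_powersetCard]
    refine ⟨⟨inter_subset_left, hu.2⟩, fun x hx => ?_, ?_⟩
    · exact mem_compl.2 (mem_sdiff.1 hx).2
    · have := card_sdiff_add_card_inter u s
      rw [inter_comm u s] at this
      omega
  · rintro ⟨a, b⟩ hx
    simp only [coe_product, Set.mem_prod, mem_coe, mem_powersetCard] at hx
    obtain ⟨⟨ha, ha'⟩, hb, hb'⟩ := hx
    simp only [coe_filter, mem_powersetCard, subset_univ, true_and, Set.mem_ofPred_eq]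
    rw [card_union_of_disjoint (hdisj ha hb), inter_union_distrib_left, inter_eq_right.2 ha]
    have : s ∩ b = ∅ := disjoint_iff_inter_eq_empty.1 (hdisj subset_rfl hb)
    rw [this, union_empty]
    omega
  · intro u hu
    change (s ∩ u) ∪ (u \ s) = u
    rw [inter_comm, union_comm, sdiff_union_inter]
  · rintro ⟨a, b⟩ hx
    simp only [coe_product, Set.mem_prod, mem_coe, mem_powersetCard] at hx
    obtain ⟨⟨ha, ha'⟩, hb, hb'⟩ := hx
    have : s ∩ b = ∅ := disjoint_iff_inter_eq_empty.1 (hdisj subset_rfl hb)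
    ext x
    · simp only [inter_union_distrib_left, this, union_empty, inter_eq_right.2 ha]
    · have h1 : x ∈ a → x ∈ s := fun h => ha h
      have h2 : x ∈ b → x ∉ s := fun h => mem_compl.1 (hb h)
      change x ∈ (a ∪ b) \ s ↔ x ∈ b
      rw [Finset.mem_sdiff, Finset.mem_union]
      tauto

theorem sum_ringWeight_card_inter {P K j : ℕ} {s : Finset (Fin P)} (hs : s.card = K) (hj : j ≤ K) :
    ∑ u, ringWeight K P u * ind ((s ∩ u).card = j)
      = (K.choose j : ℝ) * ((P - K).choose (K - j) : ℝ) / (P.choose K : ℝ) := by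
  rw [sum_ringWeight_mul]
  congr 1
  have := card_inter_eq hs hj
  rw [card_filter] at this
  rw [← Nat.cast_mul, ← this]
  push_cast
  refine sum_congr rfl fun u _ => ?_
  by_cases h : (s ∩ u).card = j <;> simp [ind, h]

theorem share_eq_ind {P : ℕ} (q : ℕ) (s t : Finset (Fin P)) :
    share q s t = ind (q ≤ (s ∩ t).card) := by
  unfold share ind
  by_cases h : q ≤ (s ∩ t).card <;> simp [h]

theorem sum_ringWeight_share {P K q : ℕ} (hKP : K ≤ P) (hqK : q ≤ K) {s : Finset (Fin P)}
    (hs : s.card = K) : ∑ u, ringWeight K P u * share q s u = psq q K P := by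
  unfold psq
  have h1 : ∀ u : Finset (Fin P), share q s u
      = 1 - ∑ j ∈ range q, ind ((s ∩ u).card = j) := by
    intro u
    rw [share_eq_ind]
    by_cases h : q ≤ (s ∩ u).card
    · rw [ind_true h, sum_eq_zero, sub_zero]
      intro j hj
      exact ind_false (by have := mem_range.1 hj; omega)
    · rw [ind_false h, sum_eq_single (s ∩ u).card, ind_true rfl, sub_self]
      · intro j _ hj; exact ind_false hj.symm
      · intro h'; exact absurd (mem_range.2 (not_le.1 h)) h'
  simp_rw [h1, mul_sub, mul_one, sum_sub_distrib, ringWeight_sum hKP, Finset.mul_sum]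
  rw [sum_comm]
  congr 1
  exact sum_congr rfl fun j hj =>
    sum_ringWeight_card_inter hs (by have := mem_range.1 hj; omega)

theorem sum_ringWeight_superset_le {P K : ℕ} (hK : 1 ≤ K) (hKP : K ≤ P) (I : Finset (Fin P)) :
    ∑ u, ringWeight K P u * ind (I ⊆ u) ≤ ((K : ℝ) / P) ^ I.card := by
  have h0 : (0 : ℝ) < P.choose K := by exact_mod_cast Nat.choose_pos hKP
  rw [sum_ringWeight_mul, div_le_iff₀ h0]
  have := card_powersetCard_superset_le (U := (univ : Finset (Fin P))) (I := I) (d := K)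
    (subset_univ _) (by simpa using hKP) (by simp; omega)
  rw [card_univ, Fintype.card_fin, card_filter] at this
  push_cast at this
  rw [mul_comm]
  refine le_trans (le_of_eq (sum_congr rfl fun u _ => ?_)) this
  by_cases h : I ⊆ u <;> simp [ind, h]

theorem sum_ringWeight_card_inter_ge_le {P K : ℕ} (hK : 1 ≤ K) (hKP : K ≤ P)
    (W : Finset (Fin P)) (m : ℕ) :
    ∑ u, ringWeight K P u * ind (m ≤ (W ∩ u).card) ≤ ((W.card : ℝ) * K / P) ^ m := by
  have h1 : ∀ u : Finset (Fin P), ind (m ≤ (W ∩ u).card)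
      ≤ ∑ I ∈ powersetCard m W, ind (I ⊆ u) := by
    intro u
    by_cases h : m ≤ (W ∩ u).card
    · obtain ⟨I, hI, hIm⟩ := exists_subset_card_eq h
      rw [ind_true h, ← ind_true (hI.trans inter_subset_right)]
      exact single_le_sum (f := fun I => ind (I ⊆ u)) (fun I _ => ind_nonneg _)
        (mem_powersetCard.2 ⟨hI.trans inter_subset_left, hIm⟩)
    · rw [ind_false h]
      exact sum_nonneg fun I _ => ind_nonneg _
  calc ∑ u, ringWeight K P u * ind (m ≤ (W ∩ u).card)
      ≤ ∑ u, ringWeight K P u * ∑ I ∈ powersetCard m W, ind (I ⊆ u) :=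
        sum_le_sum fun u _ => mul_le_mul_of_nonneg_left (h1 u) (ringWeight_nonneg _ _ _)
    _ = ∑ I ∈ powersetCard m W, ∑ u, ringWeight K P u * ind (I ⊆ u) := by
        simp_rw [Finset.mul_sum]; exact sum_comm
    _ ≤ ∑ I ∈ powersetCard m W, ((K : ℝ) / P) ^ m := by
        refine sum_le_sum fun I hI => ?_
        rw [← (mem_powersetCard.1 hI).2]
        exact sum_ringWeight_superset_le hK hKP I
    _ = W.card.choose m * ((K : ℝ) / P) ^ m := by simp
    _ ≤ (W.card : ℝ) ^ m * ((K : ℝ) / P) ^ m := by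
        gcongr
        exact_mod_cast Nat.choose_le_pow _ _
    _ = _ := by rw [← mul_pow, mul_div_assoc]

theorem sum_ringWeight_share_share_le {P K : ℕ} (hK : 1 ≤ K) (hKP : K ≤ P) (q : ℕ)
    {s t : Finset (Fin P)} (hs : s.card = K) (ht : t.card = K) :
    ∑ u, ringWeight K P u * (share q s u * share q t u)
      ≤ (2 * ((K : ℝ) ^ 2 / P)) ^ (q + 1) + (((s ∩ t).card : ℝ) * K / P) ^ q := by
  have h1 : ∀ u : Finset (Fin P), share q s u * share q t u
      ≤ ind (q + 1 ≤ ((s ∪ t) ∩ u).card) + ind (q ≤ ((s ∩ t) ∩ u).card) := by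
    intro u
    rw [share_eq_ind, share_eq_ind, ← ind_and]
    by_cases h : q ≤ (s ∩ u).card ∧ q ≤ (t ∩ u).card
    · rw [ind_true h]
      have hcard := card_union_add_card_inter (s ∩ u) (t ∩ u)
      have e1 : (s ∩ u) ∪ (t ∩ u) = (s ∪ t) ∩ u := (union_inter_distrib_right s t u).symm
      have e2 : (s ∩ u) ∩ (t ∩ u) = (s ∩ t) ∩ u := (inter_inter_distrib_right s t u).symm
      rw [e1, e2] at hcard
      by_cases h' : q + 1 ≤ ((s ∪ t) ∩ u).card
      · rw [ind_true h']; linarith [ind_nonneg (q ≤ ((s ∩ t) ∩ u).card)]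
      · rw [ind_true (show q ≤ ((s ∩ t) ∩ u).card by omega)]
        linarith [ind_nonneg (q + 1 ≤ ((s ∪ t) ∩ u).card)]
    · rw [ind_false h]
      exact add_nonneg (ind_nonneg _) (ind_nonneg _)
  calc ∑ u, ringWeight K P u * (share q s u * share q t u)
      ≤ ∑ u, ringWeight K P u *
          (ind (q + 1 ≤ ((s ∪ t) ∩ u).card) + ind (q ≤ ((s ∩ t) ∩ u).card)) :=
        sum_le_sum fun u _ => mul_le_mul_of_nonneg_left (h1 u) (ringWeight_nonneg _ _ _)
    _ ≤ (((s ∪ t).card : ℝ) * K / P) ^ (q + 1) + (((s ∩ t).card : ℝ) * K / P) ^ q := by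
        simp_rw [mul_add, sum_add_distrib]
        exact add_le_add (sum_ringWeight_card_inter_ge_le hK hKP _ _)
          (sum_ringWeight_card_inter_ge_le hK hKP _ _)
    _ ≤ _ := by
        have : (s ∪ t).card ≤ 2 * K := by
          have := card_union_le s t
          omega
        have h' : ((s ∪ t).card : ℝ) ≤ 2 * K := by exact_mod_cast this
        have h2 : ((s ∪ t).card : ℝ) * K / P ≤ 2 * ((K : ℝ) ^ 2 / P) := by
          rw [← mul_div_assoc]
          refine div_le_div_of_nonneg_right ?_ (Nat.cast_nonneg _)
          nlinarith [Nat.cast_nonneg (α := ℝ) K]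
        have h3 : (0 : ℝ) ≤ ((s ∪ t).card : ℝ) * K / P := by positivity
        exact add_le_add (pow_le_pow_left₀ h3 h2 _) le_rfl

theorem le_psq {P K q : ℕ} (hK : 1 ≤ K) (hqK : 2 * q ≤ K) (hP : 4 * K ^ 2 ≤ P) :
    ((K : ℝ) ^ 2 / P) ^ q / (2 * 4 ^ q * q.factorial) ≤ psq q K P := by
  have hKP : 4 * K ≤ P := by nlinarith
  have hKP' : K ≤ P := by omega
  obtain ⟨s, -, hs⟩ := exists_subset_card_eq (s := (univ : Finset (Fin P))) (n := K)
    (by simpa using hKP')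
  rw [← sum_ringWeight_share hKP' (by omega) hs]
  have h1 : ∑ u, ringWeight K P u * ind ((s ∩ u).card = q)
      ≤ ∑ u, ringWeight K P u * share q s u := by
    refine sum_le_sum fun u _ => mul_le_mul_of_nonneg_left ?_ (ringWeight_nonneg _ _ _)
    rw [share_eq_ind]
    exact ind_mono fun h => h.ge
  refine le_trans ?_ h1
  rw [sum_ringWeight_card_inter hs (by omega)]
  have hKpos : (0 : ℝ) < K := by exact_mod_cast hK
  have hPpos : (0 : ℝ) < P := by exact_mod_cast (show 0 < P by omega)
  -- lower bounds for the two binomial coefficients in the numerator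
  have a1 : ((K : ℝ) / 2) ^ q / q.factorial ≤ K.choose q := by
    rw [div_le_iff₀ (by positivity)]
    have := Nat.pow_sub_le_descFactorial K q
    rw [Nat.descFactorial_eq_factorial_mul_choose] at this
    have h2 : ((K + 1 - q : ℕ) : ℝ) ^ q ≤ q.factorial * K.choose q := by exact_mod_cast this
    rw [mul_comm]
    refine le_trans ?_ h2
    gcongr
    rw [div_le_iff₀ (by norm_num)]
    exact_mod_cast (show K ≤ (K + 1 - q) * 2 by omega)
  have a2 : ((P : ℝ) - 2 * K) ^ (K - q) / (K - q).factorial ≤ (P - K).choose (K - q) := by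
    rw [div_le_iff₀ (by positivity)]
    have := Nat.pow_sub_le_descFactorial (P - K) (K - q)
    rw [Nat.descFactorial_eq_factorial_mul_choose] at this
    have h2 : ((P - K + 1 - (K - q) : ℕ) : ℝ) ^ (K - q)
      ≤ (K - q).factorial * (P - K).choose (K - q) := by exact_mod_cast this
    rw [mul_comm] at h2
    refine le_trans ?_ h2
    have h3 : (P : ℝ) - 2 * K = ((P - 2 * K : ℕ) : ℝ) := by
      rw [Nat.cast_sub (by omega)]; push_cast; ring
    have h4 : P - 2 * K ≤ P - K + 1 - (K - q) := by omega
    rw [h3]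
    exact pow_le_pow_left₀ (Nat.cast_nonneg _) (by exact_mod_cast h4) _
  have a3 : (P.choose K : ℝ) ≤ (P : ℝ) ^ K / K.factorial := Nat.choose_le_pow_div _ _
  have a4 : (1 : ℝ) / 2 ≤ (1 - 2 * K / P) ^ (K - q) := by
    have hx : (2 : ℝ) * K / P ≤ 1 := by
      rw [div_le_one hPpos]; exact_mod_cast (show 2 * K ≤ P by omega)
    have b1 : (1 - 2 * (K : ℝ) / P) ^ K ≤ (1 - 2 * K / P) ^ (K - q) :=
      pow_le_pow_of_le_one (by linarith) (by have : (0 : ℝ) ≤ 2 * K / P := by positivity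
                                             linarith) (by omega)
    have b2 := one_add_mul_le_pow (show (-2 : ℝ) ≤ -(2 * K / P) by linarith) K
    have b3 : (K : ℝ) * (2 * K / P) ≤ 1 / 2 := by
      rw [← mul_div_assoc, div_le_iff₀ hPpos]
      have : (4 : ℝ) * K ^ 2 ≤ P := by exact_mod_cast hP
      nlinarith
    rw [← sub_eq_add_neg] at b2
    nlinarith
  have a5 : ((K : ℝ) / 2) ^ q * (K - q).factorial ≤ K.factorial := by
    have h2 : (K - q).factorial * K.descFactorial q = K.factorial :=
      Nat.factorial_mul_descFactorial (by omega)
    have h3 := Nat.pow_sub_le_descFactorial K q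
    have h2' : ((K - q).factorial : ℝ) * K.descFactorial q = K.factorial := by exact_mod_cast h2
    rw [← h2', mul_comm]
    gcongr
    refine le_trans ?_ (show ((K + 1 - q : ℕ) : ℝ) ^ q ≤ K.descFactorial q by exact_mod_cast h3)
    gcongr
    rw [div_le_iff₀ (by norm_num)]
    exact_mod_cast (show K ≤ (K + 1 - q) * 2 by omega)
  have hch : (0 : ℝ) < P.choose K := by exact_mod_cast Nat.choose_pos hKP'
  rw [le_div_iff₀ hch]
  have hPK : (0 : ℝ) ≤ (P : ℝ) - 2 * K := by
    have : (2 * K : ℝ) ≤ P := by exact_mod_cast (show 2 * K ≤ P by omega)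
    linarith
  have a6 : ((P : ℝ) - 2 * K) ^ (K - q) = (1 - 2 * K / P) ^ (K - q) * P ^ (K - q) := by
    rw [← mul_pow]; congr 1; field_simp
  have hPow : (P : ℝ) ^ K = P ^ (K - q) * P ^ q := by
    rw [← pow_add]; congr 1; omega
  calc ((K : ℝ) ^ 2 / P) ^ q / (2 * 4 ^ q * q.factorial) * P.choose K
      ≤ ((K : ℝ) ^ 2 / P) ^ q / (2 * 4 ^ q * q.factorial) * (P ^ K / K.factorial) := by gcongr
    _ = ((K : ℝ) / 2) ^ q / q.factorial *
          ((((K : ℝ) / 2) ^ q / K.factorial) * (1 / 2 * P ^ (K - q))) := by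
        rw [hPow, div_pow, div_pow, ← pow_mul, show (4 : ℝ) = 2 * 2 by norm_num, mul_pow,
          pow_mul, pow_two, mul_pow]
        field_simp
    _ ≤ ((K : ℝ) / 2) ^ q / q.factorial *
          ((1 / (K - q).factorial) * ((1 - 2 * K / P) ^ (K - q) * P ^ (K - q))) := by
        have a7 : ((K : ℝ) / 2) ^ q / K.factorial ≤ 1 / (K - q).factorial := by
          rw [div_le_div_iff₀ (by positivity) (by positivity)]
          linarith
        have a8 := mul_le_mul_of_nonneg_right a4 (show (0 : ℝ) ≤ (P : ℝ) ^ (K - q) by positivity)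
        exact mul_le_mul_of_nonneg_left
          (mul_le_mul a7 a8 (by positivity) (by positivity)) (by positivity)
    _ = ((K : ℝ) / 2) ^ q / q.factorial * (((P : ℝ) - 2 * K) ^ (K - q) / (K - q).factorial) := by
        rw [a6]; ring
    _ ≤ K.choose q * (P - K).choose (K - q) := by
        gcongr

/-! ### First and second moments of the number of vertices of given degree -/

theorem ind_card_nbrIn (q n P : ℕ) (ω : Config n P) (i : Fin n) (T : Finset (Fin n)) (d : ℕ) :
    ind ((nbrIn q n P ω i T).card = d)
      = ∑ A ∈ powersetCard d T, ind (nbrIn q n P ω i T = A) := by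
  classical
  have hsub : nbrIn q n P ω i T ⊆ T := filter_subset _ _
  by_cases h : (nbrIn q n P ω i T).card = d
  · rw [ind_true h, sum_eq_single (nbrIn q n P ω i T), ind_true rfl]
    · intro A _ hA; exact ind_false hA.symm
    · intro h'; exact absurd (mem_powersetCard.2 ⟨hsub, h⟩) h'
  · rw [ind_false h, sum_eq_zero]
    intro A hA
    exact ind_false fun h' => h (by rw [h']; exact (mem_powersetCard.1 hA).2)

theorem degree_eq_card (q n P : ℕ) (ω : Config n P) (i : Fin n) :
    degree q n P ω i = (nbrIn q n P ω i (univ.erase i)).card := by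
  classical
  unfold degree nbrIn
  rw [Nat.card_eq_fintype_card, Fintype.card_subtype]
  congr 1
  ext j
  simp only [mem_filter, mem_univ, true_and, mem_erase, and_true]
  exact ⟨fun h => ⟨h.1.symm, h⟩, fun h => h.2⟩

theorem prod_coe_agree {α : Type*} {T A : Finset α} (hA : A ⊆ T) (x : ℝ) :
    ∏ l : T, agree ((l : α) ∈ A) x = x ^ A.card * (1 - x) ^ (T.card - A.card) := by
  classical
  rw [Finset.prod_coe_sort T (fun l => agree (l ∈ A) x)]
  have h : ∀ l, agree (l ∈ A) x = if l ∈ A then x else 1 - x := fun l => by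
    unfold agree; congr
  simp_rw [h]
  rw [Finset.prod_ite, Finset.prod_const, Finset.prod_const, filter_mem_eq_inter,
    inter_eq_right.2 hA, ← card_sdiff_of_subset hA]
  congr 3
  ext l; simp

theorem graphExpect_degree {q n K P : ℕ} (hqK : q ≤ K) (hKP : K ≤ P) (p : ℝ) (i : Fin n) (d : ℕ) :
    graphExpect n K P p (fun ω => ind (degree q n P ω i = d))
      = (n - 1).choose d * (peq q K P p ^ d * (1 - peq q K P p) ^ (n - 1 - d)) := by
  simp_rw [degree_eq_card, ind_card_nbrIn]
  rw [graphExpect_sum]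
  have hT : (univ.erase i : Finset (Fin n)).card = n - 1 := by simp
  have h : ∀ A ∈ powersetCard d (univ.erase i : Finset (Fin n)),
      graphExpect n K P p (fun ω => ind (nbrIn q n P ω i (univ.erase i) = A))
        = peq q K P p ^ d * (1 - peq q K P p) ^ (n - 1 - d) := by
    intro A hA
    rw [mem_powersetCard] at hA
    rw [graphExpect_nbrIn hKP p (by simp) hA.1]
    have h1 : ∀ s, ringWeight K P s * ∏ l : (univ.erase i : Finset (Fin n)),
        agree ((l : Fin n) ∈ A) (p * ∑ u, ringWeight K P u * share q s u)
        = ringWeight K P s * (peq q K P p ^ d * (1 - peq q K P p) ^ (n - 1 - d)) := by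
      intro s
      by_cases hs : s.card = K
      · rw [sum_ringWeight_share hKP hqK hs, prod_coe_agree hA.1, hA.2, hT, peq]
      · simp [ringWeight, hs]
    rw [sum_congr rfl fun s _ => h1 s, ← sum_mul, ringWeight_sum hKP, one_mul]
  rw [sum_congr rfl h, sum_const, card_powersetCard, hT, nsmul_eq_mul]

/-- Probability that a random key ring shares at least `q` keys with both `s` and `t`. -/
noncomputable def jointShare (q K P : ℕ) (s t : Finset (Fin P)) : ℝ :=
  ∑ u, ringWeight K P u * (share q s u * share q t u)

theorem jointShare_nonneg (q K P : ℕ) (s t : Finset (Fin P)) : 0 ≤ jointShare q K P s t :=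
  sum_nonneg fun _ _ => mul_nonneg (ringWeight_nonneg _ _ _)
    (mul_nonneg (share_nonneg _ _ _) (share_nonneg _ _ _))

theorem jointShare_le_psq {q K P : ℕ} (hqK : q ≤ K) (hKP : K ≤ P) {s : Finset (Fin P)}
    (hs : s.card = K) (t : Finset (Fin P)) : jointShare q K P s t ≤ psq q K P := by
  rw [← sum_ringWeight_share hKP hqK hs]
  refine sum_le_sum fun u _ => mul_le_mul_of_nonneg_left ?_ (ringWeight_nonneg _ _ _)
  exact mul_le_of_le_one_right (share_nonneg _ _ _) (share_le_one _ _ _)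

theorem sum_pow_card_inter_le {α : Type*} [DecidableEq α] {T A : Finset α} (hA : A ⊆ T) {d : ℕ}
    (hd : d ≤ T.card) (hT : 0 < T.card) {x : ℝ} (hx : 0 ≤ x) :
    ∑ B ∈ powersetCard d T, x ^ (A ∩ B).card
      ≤ T.card.choose d * (x * ((d : ℝ) / T.card) + 1) ^ A.card := by
  have h1 : ∀ B, x ^ (A ∩ B).card ≤ ∑ I ∈ A.powerset, if I ⊆ B then x ^ I.card else 0 := by
    intro B
    refine le_trans (le_of_eq ?_) (single_le_sum
      (f := fun I : Finset α => if I ⊆ B then x ^ I.card else 0) (fun I _ => ?_)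
      (mem_powerset.2 (inter_subset_left : A ∩ B ⊆ A)))
    · simp
    · split_ifs <;> positivity
  calc ∑ B ∈ powersetCard d T, x ^ (A ∩ B).card
      ≤ ∑ B ∈ powersetCard d T, ∑ I ∈ A.powerset, (if I ⊆ B then x ^ I.card else 0) :=
        sum_le_sum fun B _ => h1 B
    _ = ∑ I ∈ A.powerset, x ^ I.card * ((powersetCard d T).filter fun B => I ⊆ B).card := by
        rw [sum_comm]
        refine sum_congr rfl fun I _ => ?_
        rw [← sum_filter, sum_const, nsmul_eq_mul, mul_comm]
    _ ≤ ∑ I ∈ A.powerset, x ^ I.card * (T.card.choose d * ((d : ℝ) / T.card) ^ I.card) := by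
        refine sum_le_sum fun I hI => mul_le_mul_of_nonneg_left ?_ (by positivity)
        exact card_powersetCard_superset_le ((mem_powerset.1 hI).trans hA) hd hT
    _ = _ := by
        rw [← Finset.sum_pow_mul_eq_add_pow, Finset.mul_sum]
        refine sum_congr rfl fun I _ => ?_
        rw [one_pow, mul_pow]; ring

theorem agree_nonneg {a : Prop} {x : ℝ} (h0 : 0 ≤ x) (h1 : x ≤ 1) : 0 ≤ agree a x := by
  unfold agree; split_ifs <;> linarith

theorem sum_agree_agree_le {q K P : ℕ} (hqK : q ≤ K) (hKP : K ≤ P) (p : ℝ)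
    (he : 0 < peq q K P p) {s t : Finset (Fin P)} (hs : s.card = K) (ht : t.card = K)
    (α β : Prop) [Decidable α] [Decidable β] :
    ∑ u, ringWeight K P u * (agree α (p * share q s u) * agree β (p * share q t u))
      ≤ Real.exp (-(2 * peq q K P p - p ^ 2 * jointShare q K P s t)) *
        ((if α then peq q K P p * Real.exp (2 * peq q K P p) else 1) *
         (if β then peq q K P p * Real.exp (2 * peq q K P p) else 1) *
         (if α ∧ β then p ^ 2 * jointShare q K P s t / peq q K P p ^ 2 else 1)) := by
  set e := peq q K P p with hedef
  set a := p ^ 2 * jointShare q K P s t with hadef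
  have ha : 0 ≤ a := mul_nonneg (sq_nonneg p) (jointShare_nonneg _ _ _ _ _)
  have es : ∑ u, ringWeight K P u * (p * share q s u) = e := by
    rw [hedef, peq, ← sum_ringWeight_share hKP hqK hs, Finset.mul_sum]
    exact sum_congr rfl fun u _ => by ring
  have et : ∑ u, ringWeight K P u * (p * share q t u) = e := by
    rw [hedef, peq, ← sum_ringWeight_share hKP hqK ht, Finset.mul_sum]
    exact sum_congr rfl fun u _ => by ring
  have ea : ∑ u, ringWeight K P u * ((p * share q s u) * (p * share q t u)) = a := by
    rw [hadef, jointShare, Finset.mul_sum]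
    exact sum_congr rfl fun u _ => by ring
  have e1 : ∑ u, ringWeight K P u = 1 := ringWeight_sum hKP
  by_cases hα : α <;> by_cases hβ : β
  · simp only [agree, hα, hβ, if_true, and_self]
    rw [ea]
    have : Real.exp (-(2 * e - a)) * (e * Real.exp (2 * e) * (e * Real.exp (2 * e)) * (a / e ^ 2))
        = a * Real.exp (2 * e + a) := by
      rw [show 2 * e + a = -(2 * e - a) + 2 * e + 2 * e by ring, Real.exp_add, Real.exp_add]
      field_simp
    rw [this]
    have := Real.one_le_exp (show 0 ≤ 2 * e + a by linarith)
    nlinarith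
  · simp only [agree, hα, hβ, if_true, if_false, and_false]
    have h : ∑ u, ringWeight K P u * (p * share q s u * (1 - p * share q t u)) = e - a := by
      rw [← es, ← ea, ← sum_sub_distrib]
      exact sum_congr rfl fun u _ => by ring
    have : Real.exp (-(2 * e - a)) * (e * Real.exp (2 * e) * 1 * 1) = e * Real.exp a := by
      rw [show a = -(2 * e - a) + 2 * e by ring, Real.exp_add]; ring_nf
    rw [h, this]
    have := Real.one_le_exp ha
    nlinarith
  · simp only [agree, hα, hβ, if_true, if_false, false_and]
    have h : ∑ u, ringWeight K P u * ((1 - p * share q s u) * (p * share q t u)) = e - a := by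
      rw [← et, ← ea, ← sum_sub_distrib]
      exact sum_congr rfl fun u _ => by ring
    have : Real.exp (-(2 * e - a)) * (1 * (e * Real.exp (2 * e)) * 1) = e * Real.exp a := by
      rw [show a = -(2 * e - a) + 2 * e by ring, Real.exp_add]; ring_nf
    rw [h, this]
    have := Real.one_le_exp ha
    nlinarith
  · simp only [agree, hα, hβ, if_false, and_self]
    have h : ∑ u, ringWeight K P u * ((1 - p * share q s u) * (1 - p * share q t u))
        = 1 - e - e + a := by
      calc _ = ∑ u, (ringWeight K P u - ringWeight K P u * (p * share q s u)
              - ringWeight K P u * (p * share q t u)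
              + ringWeight K P u * ((p * share q s u) * (p * share q t u))) :=
            sum_congr rfl fun u _ => by ring
        _ = _ := by rw [sum_add_distrib, sum_sub_distrib, sum_sub_distrib, e1, es, et, ea]
    rw [h]
    have := Real.add_one_le_exp (-(2 * e - a))
    linarith

theorem prod_coe_ite_mem {α : Type*} [DecidableEq α] {T A : Finset α} (hA : A ⊆ T) (x : ℝ) :
    ∏ l : T, (if (l : α) ∈ A then x else 1) = x ^ A.card := by
  rw [Finset.prod_coe_sort T (fun l => if l ∈ A then x else 1), Finset.prod_ite_mem,
    inter_eq_right.2 hA, prod_const]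

theorem sum_prod_agree_agree_le {q n K P : ℕ} (hqK : q ≤ K) (hKP : K ≤ P) {p : ℝ}
    (hp : p ∈ Set.Ioc (0 : ℝ) 1) (hn : 4 ≤ n) (he : 1 ≤ n * peq q K P p)
    {s t : Finset (Fin P)} (hs : s.card = K) (ht : t.card = K)
    {T : Finset (Fin n)} (hT : T.card = n - 2) {d : ℕ} (hd : d ≤ n - 2) :
    ∑ A ∈ powersetCard d T, ∑ B ∈ powersetCard d T, ∏ l : T, ∑ u, ringWeight K P u *
        (agree ((l : Fin n) ∈ A) (p * share q s u) * agree ((l : Fin n) ∈ B) (p * share q t u))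
      ≤ ((n * peq q K P p) ^ d / d.factorial) ^ 2 * Real.exp (-(2 * (n * peq q K P p))) *
        Real.exp ((1 + 2 * d ^ 2) * (n * (p ^ 2 * jointShare q K P s t))
          + 4 * peq q K P p * (1 + d)) := by
  classical
  have hnpos : (0 : ℝ) < n := by exact_mod_cast (show 0 < n by omega)
  have hepos : 0 < peq q K P p := by
    by_contra h
    push Not at h
    nlinarith
  have hκ := fun (α β : Prop) => sum_agree_agree_le hqK hKP p hepos hs ht α β
  set e := peq q K P p with hedef
  set a := p ^ 2 * jointShare q K P s t with hadef
  have ha : 0 ≤ a := mul_nonneg (sq_nonneg p) (jointShare_nonneg _ _ _ _ _)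
  have hNpos : 0 < T.card := by omega
  have hN : (T.card : ℝ) = n - 2 := by
    rw [hT, Nat.cast_sub (by omega)]; norm_num
  have hn4 : (4 : ℝ) ≤ n := by exact_mod_cast hn
  have hag : ∀ (c : Prop) (w u : Finset (Fin P)), 0 ≤ agree c (p * share q w u) := fun c w u =>
    agree_nonneg (mul_nonneg hp.1.le (share_nonneg _ _ _))
      (mul_le_one₀ hp.2 (share_nonneg _ _ _) (share_le_one _ _ _))
  set c := e * Real.exp (2 * e) with hc
  set x := a / e ^ 2 with hx
  have hx0 : 0 ≤ x := by positivity
  have hc0 : 0 ≤ c := by positivity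
  set E := Real.exp (-(2 * e - a)) with hE
  have hterm : ∀ A ∈ powersetCard d T, ∀ B ∈ powersetCard d T,
      ∏ l : T, ∑ u, ringWeight K P u * (agree ((l : Fin n) ∈ A) (p * share q s u) *
        agree ((l : Fin n) ∈ B) (p * share q t u))
      ≤ E ^ T.card * (c ^ d * c ^ d) * x ^ (A ∩ B).card := by
    intro A hA B hB
    rw [mem_powersetCard] at hA hB
    calc _ ≤ ∏ l : T, (E * ((if (l : Fin n) ∈ A then c else 1) * (if (l : Fin n) ∈ B then c else 1)
            * (if (l : Fin n) ∈ A ∩ B then x else 1))) := by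
          refine prod_le_prod (fun l _ => ?_) fun l _ => ?_
          · exact sum_nonneg fun u _ => mul_nonneg (ringWeight_nonneg _ _ _)
              (mul_nonneg (hag _ _ _) (hag _ _ _))
          · simp only [Finset.mem_inter]
            exact sum_agree_agree_le hqK hKP p hepos hs ht _ _
      _ = _ := by
          rw [prod_mul_distrib, prod_mul_distrib, prod_mul_distrib, prod_coe_ite_mem hA.1,
            prod_coe_ite_mem hB.1, prod_coe_ite_mem (inter_subset_left.trans hA.1), hA.2, hB.2,
            prod_const, card_univ, Fintype.card_coe]
          ring
  have hsum : ∑ A ∈ powersetCard d T, ∑ B ∈ powersetCard d T, ∏ l : T, ∑ u, ringWeight K P u *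
        (agree ((l : Fin n) ∈ A) (p * share q s u) * agree ((l : Fin n) ∈ B) (p * share q t u))
      ≤ E ^ T.card * (c ^ d * c ^ d) *
        (T.card.choose d * (T.card.choose d * (x * ((d : ℝ) / T.card) + 1) ^ d)) := by
    calc _ ≤ ∑ A ∈ powersetCard d T, E ^ T.card * (c ^ d * c ^ d) *
            (T.card.choose d * (x * ((d : ℝ) / T.card) + 1) ^ d) := by
          refine sum_le_sum fun A hA => ?_
          refine (sum_le_sum fun B hB => hterm A hA B hB).trans ?_
          rw [← Finset.mul_sum]
          refine mul_le_mul_of_nonneg_left ?_ (by positivity)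
          rw [mem_powersetCard] at hA
          have := sum_pow_card_inter_le hA.1 (by omega) hNpos hx0 (d := d)
          rwa [hA.2] at this
      _ = _ := by
          rw [sum_const, card_powersetCard, nsmul_eq_mul]; ring
  refine hsum.trans ?_
  have b1 : (T.card.choose d : ℝ) ≤ (n : ℝ) ^ d / d.factorial := by
    refine (Nat.choose_le_pow_div _ _).trans ?_
    gcongr
    omega
  have b2 : (x * ((d : ℝ) / T.card) + 1) ^ d ≤ Real.exp (2 * d ^ 2 * (n * a)) := by
    have h1 : x * ((d : ℝ) / T.card) ≤ 2 * d * (n * a) := by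
      have hTpos : (0 : ℝ) < T.card := by exact_mod_cast hNpos
      rw [hx, div_mul_div_comm, div_le_iff₀ (by positivity)]
      have h2 : (1 : ℝ) ≤ n * 2 * (e ^ 2 * T.card) := by
        rw [hN]
        have h3 : (1 : ℝ) ≤ (n * e) ^ 2 := one_le_pow₀ he
        have h4 : (n : ℝ) ≤ 2 * (n - 2) := by linarith
        have h5 : 0 ≤ n * e ^ 2 := by positivity
        nlinarith
      have h6 : 0 ≤ a * d := by positivity
      nlinarith
    calc (x * ((d : ℝ) / T.card) + 1) ^ d ≤ Real.exp (2 * d * (n * a)) ^ d := by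
          refine pow_le_pow_left₀ (by positivity) ?_ _
          exact (Real.add_one_le_exp _).trans (Real.exp_le_exp.2 h1)
      _ = _ := by rw [← Real.exp_nat_mul]; ring_nf
  have b3 : E ^ T.card ≤ Real.exp (-(2 * (n * e)) + n * a + 4 * e) := by
    rw [hE, ← Real.exp_nat_mul, hN]
    refine Real.exp_le_exp.2 ?_
    nlinarith
  have b4 : c ^ d * c ^ d = e ^ d * e ^ d * Real.exp (4 * e * d) := by
    rw [hc, mul_pow, ← Real.exp_nat_mul,
      show 4 * e * d = (d : ℝ) * (2 * e) + d * (2 * e) by ring, Real.exp_add]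
    ring
  calc E ^ T.card * (c ^ d * c ^ d) *
        (T.card.choose d * (T.card.choose d * (x * ((d : ℝ) / T.card) + 1) ^ d))
      ≤ Real.exp (-(2 * (n * e)) + n * a + 4 * e) * (c ^ d * c ^ d) *
        ((n : ℝ) ^ d / d.factorial * ((n : ℝ) ^ d / d.factorial *
          Real.exp (2 * d ^ 2 * (n * a)))) := by gcongr
    _ = _ := by
        rw [b4, show (1 + 2 * (d : ℝ) ^ 2) * (n * a) + 4 * e * (1 + d)
          = n * a + 4 * e + 2 * d ^ 2 * (n * a) + 4 * e * d by ring]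
        simp only [Real.exp_add]
        rw [mul_pow]
        ring

theorem adj_symm {q n P : ℕ} {ω : Config n P} {i j : Fin n} (h : Adj q n P ω i j) :
    Adj q n P ω j i :=
  ⟨h.1.symm, by rw [inter_comm]; exact h.2.1, by rw [Sym2.eq_swap]; exact h.2.2⟩

theorem degree_eq_card_add {q n P : ℕ} (ω : Config n P) {i j : Fin n} (hij : i ≠ j)
    {T : Finset (Fin n)} (hT : ∀ l, l ∈ T ↔ l ≠ i ∧ l ≠ j) [Decidable (Adj q n P ω i j)] :
    degree q n P ω i = (nbrIn q n P ω i T).card + if Adj q n P ω i j then 1 else 0 := by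
  classical
  have hins : univ.erase i = insert j T := by
    ext l
    simp only [mem_erase, mem_univ, and_true, Finset.mem_insert, hT]
    by_cases h : l = j
    · simp [h, hij.symm]
    · simp [h]
  rw [degree_eq_card, hins]
  unfold nbrIn
  rw [filter_insert]
  split_ifs with h
  · rw [card_insert_of_notMem]
    simp [hT]
  · rfl

theorem ind_degree_degree_le {q n P h : ℕ} (ω : Config n P) {i j : Fin n} (hij : i ≠ j)
    {T : Finset (Fin n)} (hT : ∀ l, l ∈ T ↔ l ≠ i ∧ l ≠ j) :
    ind (degree q n P ω i = h ∧ degree q n P ω j = h)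
      ≤ ind ((nbrIn q n P ω i T).card = h) * ind ((nbrIn q n P ω j T).card = h)
        + share q (ω.1 i) (ω.1 j) *
          (ind ((nbrIn q n P ω i T).card = h - 1) * ind ((nbrIn q n P ω j T).card = h - 1)) := by
  classical
  rw [degree_eq_card_add ω hij hT, degree_eq_card_add ω hij.symm (fun l => by rw [hT l, and_comm])]
  rw [← ind_and, ← ind_and]
  by_cases hadj : Adj q n P ω i j
  · rw [if_pos hadj, if_pos (adj_symm hadj), share_eq_ind, ind_true hadj.2.1, one_mul]
    refine le_add_of_nonneg_of_le (ind_nonneg _) (ind_mono ?_)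
    omega
  · rw [if_neg hadj, if_neg fun h => hadj (adj_symm h)]
    exact le_add_of_le_of_nonneg le_rfl (mul_nonneg (share_nonneg _ _ _) (ind_nonneg _))

/-- Exponential moment of the joint neighbourhood probability of two random key rings. -/
noncomputable def overlapMoment (q n K P : ℕ) (p D : ℝ) : ℝ :=
  ∑ s, ringWeight K P s * ∑ t, ringWeight K P t *
    Real.exp (D * (n * (p ^ 2 * jointShare q K P s t)))

theorem graphExpect_card_pair_le {q n K P : ℕ} (hqK : q ≤ K) (hKP : K ≤ P) {p : ℝ}
    (hp : p ∈ Set.Ioc (0 : ℝ) 1) (hn : 4 ≤ n) (he : 1 ≤ n * peq q K P p)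
    {i j : Fin n} (hij : i ≠ j) {T : Finset (Fin n)} (hT : ∀ l, l ∈ T ↔ l ≠ i ∧ l ≠ j)
    {d h : ℕ} (hdh : d ≤ h) (hh : h ≤ n - 2) {Φ : Finset (Fin P) → Finset (Fin P) → ℝ}
    (hΦ1 : ∀ s t, Φ s t ≤ 1) :
    graphExpect n K P p (fun ω => Φ (ω.1 i) (ω.1 j) *
      (ind ((nbrIn q n P ω i T).card = d) * ind ((nbrIn q n P ω j T).card = d)))
      ≤ ((n * peq q K P p) ^ d / d.factorial) ^ 2 * Real.exp (-(2 * (n * peq q K P p))) *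
        Real.exp (4 * peq q K P p * (1 + h)) * overlapMoment q n K P p (1 + 2 * h ^ 2) := by
  classical
  have hi : i ∉ T := by rw [hT]; simp
  have hj : j ∉ T := by rw [hT]; simp
  have hTc : T.card = n - 2 := by
    have : T = (univ.erase i).erase j := by
      ext l; rw [hT]; simp [and_comm]
    rw [this, card_erase_of_mem (by simp [hij.symm]), card_erase_of_mem (by simp), card_univ,
      Fintype.card_fin]
    omega
  have hnpos : (0 : ℝ) < n := by exact_mod_cast (show 0 < n by omega)
  have hepos : 0 < peq q K P p := by
    by_contra h
    push Not at h
    nlinarith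
  simp_rw [ind_card_nbrIn, sum_mul_sum, Finset.mul_sum]
  rw [graphExpect_sum]
  simp_rw [graphExpect_sum]
  have h1 : ∀ A ∈ powersetCard d T, ∀ B ∈ powersetCard d T, _ := fun A hA B hB =>
    graphExpect_nbrIn_pair (q := q) hKP p hij hi hj (mem_powersetCard.1 hA).1
      (mem_powersetCard.1 hB).1 Φ
  rw [sum_congr rfl fun A hA => sum_congr rfl fun B hB => h1 A hA B hB]
  have h2 : ∀ G : Finset (Fin n) → Finset (Fin n) → Finset (Fin P) → Finset (Fin P) → ℝ,
      ∑ A ∈ powersetCard d T, ∑ B ∈ powersetCard d T, ∑ s, ringWeight K P s *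
        ∑ t, ringWeight K P t * (Φ s t * G A B s t)
      = ∑ s, ringWeight K P s * ∑ t, ringWeight K P t * (Φ s t *
          ∑ A ∈ powersetCard d T, ∑ B ∈ powersetCard d T, G A B s t) := by
    intro G
    simp_rw [Finset.mul_sum]
    rw [sum_congr rfl fun A _ => sum_comm, sum_comm]
    refine sum_congr rfl fun s _ => ?_
    rw [sum_congr rfl fun A _ => sum_comm, sum_comm]
  rw [h2]
  unfold overlapMoment
  rw [Finset.mul_sum]
  refine sum_le_sum fun s _ => ?_
  by_cases hs : s.card = K
  swap
  · simp [ringWeight, hs]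
  rw [mul_left_comm]
  refine mul_le_mul_of_nonneg_left ?_ (ringWeight_nonneg _ _ _)
  rw [Finset.mul_sum]
  refine sum_le_sum fun t _ => ?_
  by_cases ht : t.card = K
  swap
  · simp [ringWeight, ht]
  rw [mul_left_comm _ (ringWeight K P t)]
  refine mul_le_mul_of_nonneg_left ?_ (ringWeight_nonneg _ _ _)
  have h3 := sum_prod_agree_agree_le hqK hKP hp hn he hs ht hTc (hdh.trans hh)
  set R := ∑ A ∈ powersetCard d T, ∑ B ∈ powersetCard d T, ∏ l : T, ∑ u, ringWeight K P u *
        (agree ((l : Fin n) ∈ A) (p * share q s u) * agree ((l : Fin n) ∈ B) (p * share q t u))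
    with hR
  have hag : ∀ (c : Prop) (w u : Finset (Fin P)), 0 ≤ agree c (p * share q w u) := fun c w u =>
    agree_nonneg (mul_nonneg hp.1.le (share_nonneg _ _ _))
      (mul_le_one₀ hp.2 (share_nonneg _ _ _) (share_le_one _ _ _))
  have hR0 : 0 ≤ R := sum_nonneg fun A _ => sum_nonneg fun B _ => prod_nonneg fun l _ =>
    sum_nonneg fun u _ => mul_nonneg (ringWeight_nonneg _ _ _)
      (mul_nonneg (hag _ _ _) (hag _ _ _))
  have hdh' : (d : ℝ) ≤ h := by exact_mod_cast hdh
  have h4 : Φ s t * R ≤ ((n * peq q K P p) ^ d / d.factorial) ^ 2 *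
      Real.exp (-(2 * (n * peq q K P p))) * (Real.exp (4 * peq q K P p * (1 + h)) *
        Real.exp ((1 + 2 * h ^ 2) * (n * (p ^ 2 * jointShare q K P s t)))) := by
    refine (mul_le_of_le_one_left hR0 (hΦ1 s t)).trans (h3.trans ?_)
    rw [← Real.exp_add]
    refine mul_le_mul_of_nonneg_left (Real.exp_le_exp.2 ?_) (by positivity)
    have := jointShare_nonneg q K P s t
    have h5 : 0 ≤ n * (p ^ 2 * jointShare q K P s t) := by positivity
    have h6 : (1 + 2 * (d : ℝ) ^ 2) ≤ 1 + 2 * h ^ 2 := by gcongr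
    have h7 : 4 * peq q K P p * (1 + (d : ℝ)) ≤ 4 * peq q K P p * (1 + h) := by gcongr
    nlinarith
  rwa [← mul_assoc] at h4

theorem graphExpect_degree_degree_le {q n K P : ℕ} (hqK : q ≤ K) (hKP : K ≤ P) {p : ℝ}
    (hp : p ∈ Set.Ioc (0 : ℝ) 1) (hn : 4 ≤ n) (he : 1 ≤ n * peq q K P p)
    {i j : Fin n} (hij : i ≠ j) {h : ℕ} (h1 : 1 ≤ h) (hh : h ≤ n - 2) :
    graphExpect n K P p (fun ω => ind (degree q n P ω i = h ∧ degree q n P ω j = h))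
      ≤ ((n * peq q K P p) ^ h / h.factorial * Real.exp (-(n * peq q K P p))) ^ 2 *
        ((1 + h ^ 2 / (n * peq q K P p) ^ 2) *
        Real.exp (4 * peq q K P p * (1 + h)) * overlapMoment q n K P p (1 + 2 * h ^ 2)) := by
  classical
  have hT : ∀ l, l ∈ (univ.filter fun l => l ≠ i ∧ l ≠ j) ↔ l ≠ i ∧ l ≠ j := by simp
  have hle := graphExpect_mono (K := K) hp
    (fun ω => ind_degree_degree_le (q := q) (h := h) (P := P) ω hij hT)
  rw [graphExpect_add] at hle
  have hA := graphExpect_card_pair_le hqK hKP hp hn he hij hT le_rfl hh (Φ := fun _ _ => 1)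
    (fun _ _ => le_rfl)
  have hB := graphExpect_card_pair_le hqK hKP hp hn he hij hT (Nat.sub_le h 1) hh
    (Φ := fun s t => share q s t) (fun _ _ => share_le_one _ _ _)
  simp only [one_mul] at hA
  refine hle.trans ((add_le_add hA hB).trans (le_of_eq ?_))
  obtain ⟨g, rfl⟩ : ∃ g, h = g + 1 := ⟨h - 1, by omega⟩
  have hpos : (0 : ℝ) < n * peq q K P p := by linarith
  generalize n * peq q K P p = lam at *
  rw [Nat.add_sub_cancel, mul_pow, ← Real.exp_nat_mul, Nat.factorial_succ]
  push_cast
  rw [show (2 : ℝ) * -lam = -(2 * lam) by ring]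
  have hg : (g : ℝ) + 1 ≠ 0 := by positivity
  field_simp
  ring

/-! ### Asymptotics of the overlap moment -/

theorem overlapMoment_le_exp {q n K P : ℕ} (hqK : q ≤ K) (hKP : K ≤ P) {p D : ℝ} (hD : 0 ≤ D) :
    overlapMoment q n K P p D ≤ Real.exp (D * (p * (n * peq q K P p))) := by
  unfold overlapMoment
  have h1 : ∀ s : Finset (Fin P), ringWeight K P s * ∑ t, ringWeight K P t *
      Real.exp (D * (n * (p ^ 2 * jointShare q K P s t)))
      ≤ ringWeight K P s * Real.exp (D * (p * (n * peq q K P p))) := by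
    intro s
    by_cases hs : s.card = K
    swap
    · simp [ringWeight, hs]
    refine mul_le_mul_of_nonneg_left ?_ (ringWeight_nonneg _ _ _)
    calc _ ≤ ∑ t, ringWeight K P t * Real.exp (D * (p * (n * peq q K P p))) := by
          refine sum_le_sum fun t _ => mul_le_mul_of_nonneg_left ?_ (ringWeight_nonneg _ _ _)
          refine Real.exp_le_exp.2 (mul_le_mul_of_nonneg_left ?_ hD)
          have h := jointShare_le_psq hqK hKP hs t
          have h2 : p * (n * peq q K P p) = n * (p ^ 2 * psq q K P) := by unfold peq; ring
          rw [h2]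
          gcongr
      _ = _ := by rw [← sum_mul, ringWeight_sum hKP, one_mul]
  refine (sum_le_sum fun s _ => h1 s).trans (le_of_eq ?_)
  rw [← sum_mul, ringWeight_sum hKP, one_mul]

theorem jointShare_le_mul_psq {q K P : ℕ} (hK : 1 ≤ K) (hqK : 2 * q ≤ K) (hP : 4 * K ^ 2 ≤ P)
    {s t : Finset (Fin P)} (hs : s.card = K) (ht : t.card = K) :
    jointShare q K P s t ≤ psq q K P * ((2 * 4 ^ q * q.factorial) *
      (2 ^ (q + 1) * ((K : ℝ) ^ 2 / P) + (((s ∩ t).card : ℝ) / K) ^ q)) := by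
  have hKP : K ≤ P := by nlinarith
  have hK0 : (0 : ℝ) < K := by exact_mod_cast hK
  have h1 : ((K : ℝ) ^ 2 / P) ^ q ≤ psq q K P * (2 * 4 ^ q * q.factorial) :=
    (div_le_iff₀ (by positivity)).1 (le_psq hK hqK hP)
  refine (sum_ringWeight_share_share_le hK hKP q hs ht).trans ?_
  have h2 : ((s ∩ t).card : ℝ) * K / P = (s ∩ t).card / K * ((K : ℝ) ^ 2 / P) := by
    field_simp
  rw [h2, mul_pow, mul_pow, ← mul_assoc, pow_succ ((K : ℝ) ^ 2 / P)]
  have h3 : (0 : ℝ) ≤ 2 ^ (q + 1) * ((K : ℝ) ^ 2 / P) + (((s ∩ t).card : ℝ) / K) ^ q := by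
    positivity
  nlinarith [mul_le_mul_of_nonneg_right h1 h3]

theorem overlapMoment_le_add {q n K P : ℕ} (hq : 1 ≤ q) (hK : 1 ≤ K) (hqK : 2 * q ≤ K)
    (hP : 4 * K ^ 2 ≤ P) {p : ℝ} (hp : p ∈ Set.Ioc (0 : ℝ) 1) {D : ℝ} (hD : 0 ≤ D) (M : ℕ) :
    overlapMoment q n K P p D ≤
      Real.exp (D * (n * peq q K P p * ((2 * 4 ^ q * q.factorial) *
        (2 ^ (q + 1) * ((K : ℝ) ^ 2 / P))))) +
      (K : ℝ) ^ 2 / P * Real.exp (D * (n * peq q K P p * ((2 * 4 ^ q * q.factorial) *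
        (2 ^ (q + 1) * ((K : ℝ) ^ 2 / P) + ((M : ℝ) / K) ^ q)))) +
      ((K : ℝ) ^ 2 / P) ^ (M + 1) * Real.exp (D * (n * peq q K P p)) := by
  have hKP : K ≤ P := by nlinarith
  have hK0 : (0 : ℝ) < K := by exact_mod_cast hK
  have hpsq : 0 ≤ psq q K P := le_trans (by positivity) (le_psq hK hqK hP)
  set E0 := Real.exp (D * (n * peq q K P p * ((2 * 4 ^ q * q.factorial) *
        (2 ^ (q + 1) * ((K : ℝ) ^ 2 / P))))) with hE0
  set E1 := Real.exp (D * (n * peq q K P p * ((2 * 4 ^ q * q.factorial) *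
        (2 ^ (q + 1) * ((K : ℝ) ^ 2 / P) + ((M : ℝ) / K) ^ q)))) with hE1
  set E2 := Real.exp (D * (n * peq q K P p)) with hE2
  have hpt : ∀ s t : Finset (Fin P), s.card = K → t.card = K →
      Real.exp (D * (n * (p ^ 2 * jointShare q K P s t)))
        ≤ E0 + ind (1 ≤ (s ∩ t).card) * E1 + ind (M + 1 ≤ (s ∩ t).card) * E2 := by
    intro s t hs ht
    have hi1 := ind_nonneg (1 ≤ (s ∩ t).card)
    have hi2 := ind_nonneg (M + 1 ≤ (s ∩ t).card)
    have hpp : ∀ x : ℝ, 0 ≤ x → n * (p ^ 2 * (psq q K P * x)) ≤ n * peq q K P p * x := by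
      intro x hx
      have : n * (p ^ 2 * (psq q K P * x)) = p * (n * peq q K P p * x) := by unfold peq; ring
      rw [this]
      refine mul_le_of_le_one_left ?_ hp.2
      have : 0 ≤ peq q K P p := mul_nonneg hp.1.le hpsq
      positivity
    have hexp : ∀ x : ℝ, 0 ≤ x → jointShare q K P s t ≤ psq q K P * x →
        Real.exp (D * (n * (p ^ 2 * jointShare q K P s t)))
          ≤ Real.exp (D * (n * peq q K P p * x)) := by
      intro x hx hJ
      refine Real.exp_le_exp.2 (mul_le_mul_of_nonneg_left (le_trans ?_ (hpp x hx)) hD)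
      gcongr
    have hJ := jointShare_le_mul_psq hK hqK hP hs ht
    have e0 := Real.exp_pos (D * (n * peq q K P p * ((2 * 4 ^ q * q.factorial) *
        (2 ^ (q + 1) * ((K : ℝ) ^ 2 / P)))))
    rw [← hE0] at e0
    have e1 : 0 < E1 := Real.exp_pos _
    have e2 : 0 < E2 := Real.exp_pos _
    by_cases hM : M + 1 ≤ (s ∩ t).card
    · have := hexp 1 zero_le_one (by
        rw [mul_one]; exact jointShare_le_psq (by omega) hKP hs t)
      rw [mul_one] at this
      rw [ind_true hM, one_mul]
      have := mul_nonneg hi1 e1.le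
      linarith
    by_cases hm : 1 ≤ (s ∩ t).card
    · have hmM : ((s ∩ t).card : ℝ) ≤ M := by
        exact_mod_cast (show (s ∩ t).card ≤ M by omega)
      have := hexp ((2 * 4 ^ q * q.factorial) *
        (2 ^ (q + 1) * ((K : ℝ) ^ 2 / P) + ((M : ℝ) / K) ^ q)) (by positivity)
        (hJ.trans (by gcongr))
      rw [ind_true hm, one_mul, ind_false hM]
      linarith
    · have h0 : (s ∩ t).card = 0 := by omega
      have hq0 : q ≠ 0 := by omega
      rw [h0, Nat.cast_zero, zero_div, zero_pow hq0, add_zero] at hJ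
      have := hexp _ (by positivity) hJ
      rw [ind_false hm, ind_false hM]
      linarith
  unfold overlapMoment
  have hin : ∀ s : Finset (Fin P), ringWeight K P s * ∑ t, ringWeight K P t *
      Real.exp (D * (n * (p ^ 2 * jointShare q K P s t)))
      ≤ ringWeight K P s * (E0 + (K : ℝ) ^ 2 / P * E1 + ((K : ℝ) ^ 2 / P) ^ (M + 1) * E2) := by
    intro s
    by_cases hs : s.card = K
    swap
    · simp [ringWeight, hs]
    refine mul_le_mul_of_nonneg_left ?_ (ringWeight_nonneg _ _ _)
    calc _ ≤ ∑ t, ringWeight K P t * (E0 + ind (1 ≤ (s ∩ t).card) * E1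
            + ind (M + 1 ≤ (s ∩ t).card) * E2) := by
          refine sum_le_sum fun t _ => ?_
          by_cases ht : t.card = K
          swap
          · simp [ringWeight, ht]
          exact mul_le_mul_of_nonneg_left (hpt s t hs ht) (ringWeight_nonneg _ _ _)
      _ = E0 + (∑ t, ringWeight K P t * ind (1 ≤ (s ∩ t).card)) * E1
            + (∑ t, ringWeight K P t * ind (M + 1 ≤ (s ∩ t).card)) * E2 := by
          simp_rw [mul_add, sum_add_distrib, ← mul_assoc, ← sum_mul]
          rw [ringWeight_sum hKP, one_mul]
      _ ≤ _ := by
          have a1 := sum_ringWeight_card_inter_ge_le hK hKP s 1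
          have a2 := sum_ringWeight_card_inter_ge_le hK hKP s (M + 1)
          rw [hs, ← pow_two] at a1 a2
          rw [pow_one] at a1
          gcongr
  refine (sum_le_sum fun s _ => hin s).trans (le_of_eq ?_)
  rw [← sum_mul, ringWeight_sum hKP, one_mul]

theorem tendsto_mul_exp_neg {c : ℝ} (hc : 0 < c) :
    Tendsto (fun n : ℕ => Real.log n * Real.exp (-(c * Real.log n))) atTop (nhds 0) := by
  have h := Real.tendsto_pow_mul_exp_neg_atTop_nhds_zero 1
  have h2 : Tendsto (fun n : ℕ => c * Real.log (n : ℝ)) atTop atTop :=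
    (Real.tendsto_log_atTop.comp tendsto_natCast_atTop_atTop).const_mul_atTop hc
  have h3 := (h.comp h2).const_mul c⁻¹
  rw [mul_zero] at h3
  refine h3.congr fun n => ?_
  simp only [Function.comp, pow_one]
  rw [← mul_assoc, ← mul_assoc, inv_mul_cancel₀ hc.ne', one_mul]

theorem eventually_overlapMoment_le {q : ℕ} (hq : 1 ≤ q) {K P : ℕ → ℕ} {p : ℕ → ℝ}
    (hK1 : ∀ n, 1 ≤ K n) (hKP : ∀ n, K n ≤ P n)
    (hp : ∀ n, p n ∈ Set.Ioc (0 : ℝ) 1)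
    (hKinf : Tendsto (fun n => (K n : ℝ)) atTop atTop)
    (hKsqP : Tendsto (fun n => ((K n : ℝ)) ^ 2 / (P n : ℝ)) atTop (nhds 0))
    (hlam : ∀ᶠ n : ℕ in atTop, 0 ≤ n * peq q (K n) (P n) (p n) ∧
      n * peq q (K n) (P n) (p n) ≤ 2 * Real.log n)
    {D : ℝ} (hD : 0 ≤ D) {ε : ℝ} (hε : 0 < ε) :
    ∀ᶠ n : ℕ in atTop, overlapMoment q n (K n) (P n) (p n) D ≤ 1 + ε := by
  have hq0 : (0 : ℝ) < q := by exact_mod_cast hq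
  have hlog : Tendsto (fun n : ℕ => Real.log (n : ℝ)) atTop atTop :=
    Real.tendsto_log_atTop.comp tendsto_natCast_atTop_atTop
  set C : ℝ := 2 * 4 ^ q * q.factorial with hC
  have hC0 : 0 < C := by positivity
  obtain ⟨M, hM⟩ := exists_nat_ge (2 * q * (2 * D + 1))
  have hK2 : ∀ᶠ n in atTop, 2 * q ≤ K n := by
    filter_upwards [hKinf.eventually_ge_atTop ((2 * q : ℕ) : ℝ)] with n hn
    exact_mod_cast hn
  have hP4 : ∀ᶠ n in atTop, 4 * K n ^ 2 ≤ P n := by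
    filter_upwards [hKsqP.eventually_le_const (show (0 : ℝ) < 1 / 4 by norm_num)] with n hn
    have : (0 : ℝ) < P n := by exact_mod_cast (hK1 n).trans (hKP n)
    rw [div_le_iff₀ this] at hn
    have : (4 : ℝ) * (K n) ^ 2 ≤ P n := by linarith
    exact_mod_cast this
  have hsmallA : ∀ᶠ n : ℕ in atTop,
      Real.exp (2 * D * (Real.log n * Real.exp (-(1 / 4 * Real.log n)))) ≤ 1 + ε := by
    have h := ((tendsto_mul_exp_neg (show (0 : ℝ) < 1 / 4 by norm_num)).const_mul (2 * D)).rexp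
    rw [mul_zero, Real.exp_zero] at h
    exact h.eventually_le_const (by linarith)
  have hexpneg : ∀ c : ℝ, 0 < c →
      Tendsto (fun n : ℕ => Real.exp (-(c * Real.log n))) atTop (nhds 0) := fun c hc =>
    Real.tendsto_exp_neg_atTop_nhds_zero.comp (hlog.const_mul_atTop hc)
  have hsmallB : ∀ᶠ n : ℕ in atTop,
      Real.exp (2 * D * (C * 2 ^ (q + 1)) * (Real.log n * Real.exp (-(1 / (2 * q) * Real.log n))))
        + Real.exp (-(1 / (4 * q) * Real.log n)) + Real.exp (-(1 * Real.log n)) ≤ 1 + ε := by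
    have h := ((tendsto_mul_exp_neg (show (0 : ℝ) < 1 / (2 * q) by positivity)).const_mul
      (2 * D * (C * 2 ^ (q + 1)))).rexp
    rw [mul_zero, Real.exp_zero] at h
    have h2 := (h.add (hexpneg (1 / (4 * q)) (by positivity))).add (hexpneg 1 one_pos)
    rw [add_zero, add_zero] at h2
    exact h2.eventually_le_const (by linarith)
  have hlogC : ∀ᶠ n : ℕ in atTop,
      2 * C * (Real.log n * Real.exp (-(1 / 4 * Real.log n))) ≤ 1 := by
    have h := (tendsto_mul_exp_neg (show (0 : ℝ) < 1 / 4 by norm_num)).const_mul (2 * C)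
    rw [mul_zero] at h
    exact h.eventually_le_const one_pos
  have ha : ∀ᶠ n : ℕ in atTop, 2 * D * (C * (2 ^ (q + 1) * ((K n : ℝ) ^ 2 / P n)
      + ((M : ℝ) / K n) ^ q)) ≤ 1 / (4 * q) := by
    have h := (((hKsqP.const_mul (2 ^ (q + 1))).add
      ((hKinf.const_div_atTop (M : ℝ)).pow q)).const_mul C).const_mul (2 * D)
    rw [zero_pow (by omega), mul_zero, add_zero, mul_zero, mul_zero] at h
    exact h.eventually_le_const (by positivity)
  filter_upwards [hK2, hP4, hsmallA, hsmallB, hlogC, ha, hlam, eventually_ge_atTop 2]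
    with n hK2 hP4 hsmallA hsmallB hlogC ha hlam hn
  have hn0 : (0 : ℝ) < n := by exact_mod_cast (show 0 < n by omega)
  have hL0 : 0 ≤ Real.log n := Real.log_natCast_nonneg n
  have hnexp : (n : ℝ) = Real.exp (Real.log n) := (Real.exp_log hn0).symm
  set L := Real.log n with hL
  rcases le_total (p n) (Real.exp (-(1 / 4 * L))) with hpn | hpn
  · refine (overlapMoment_le_exp (by omega) (hKP n) hD).trans (le_trans ?_ hsmallA)
    refine Real.exp_le_exp.2 ?_
    rw [mul_comm 2 D, mul_assoc]
    refine mul_le_mul_of_nonneg_left ?_ hD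
    calc p n * (n * peq q (K n) (P n) (p n)) ≤ Real.exp (-(1 / 4 * L)) * (2 * L) :=
          mul_le_mul hpn hlam.2 hlam.1 (Real.exp_pos _).le
      _ = _ := by ring
  · set y : ℝ := (K n : ℝ) ^ 2 / P n with hy
    have hy0 : 0 ≤ y := by positivity
    have hyq : y ^ q ≤ psq q (K n) (P n) * C :=
      (div_le_iff₀ (by positivity)).1 (le_psq (hK1 n) hK2 hP4)
    have hpsq : 0 ≤ psq q (K n) (P n) := by
      by_contra h
      push Not at h
      have : 0 ≤ y ^ q := by positivity
      nlinarith
    have h1 : psq q (K n) (P n) * (Real.exp (-(1 / 4 * L)) * Real.exp L) ≤ 2 * L := by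
      refine le_trans ?_ hlam.2
      rw [← hnexp]
      have : n * peq q (K n) (P n) (p n) = psq q (K n) (P n) * (p n * n) := by unfold peq; ring
      rw [this]
      gcongr
    have hy1 : y ≤ Real.exp (-(1 / (2 * q) * L)) := by
      refine le_of_pow_le_pow_left₀ (n := q) (by omega) (Real.exp_pos _).le (hyq.trans ?_)
      rw [← Real.exp_nat_mul]
      have h2 : (q : ℝ) * -(1 / (2 * q) * L) = -(1 / 4 * L) + -(1 / 4 * L) := by
        field_simp; ring
      have h3 : Real.exp (-(1 / 4 * L)) * Real.exp L * Real.exp (-(1 / 4 * L) + -(1 / 4 * L))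
          = Real.exp (1 / 4 * L) := by
        rw [← Real.exp_add, ← Real.exp_add]; congr 1; ring
      rw [h2]
      have h4 : 0 < Real.exp (-(1 / 4 * L)) * Real.exp L := by positivity
      refine le_of_mul_le_mul_left ?_ h4
      rw [h3]
      have h5 : Real.exp (-(1 / 4 * L)) * Real.exp (1 / 4 * L) = 1 := by
        rw [← Real.exp_add]; simp
      have h6 : 0 < Real.exp (-(1 / 4 * L)) := Real.exp_pos _
      refine le_of_mul_le_mul_left ?_ h6
      rw [h5]
      refine le_trans ?_ hlogC
      have := mul_le_mul_of_nonneg_left h1 (mul_pos hC0 h6).le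
      nlinarith
    refine (overlapMoment_le_add hq (hK1 n) hK2 hP4 (hp n) hD M).trans (le_trans ?_ hsmallB)
    obtain ⟨hlam0, hlam2⟩ := hlam
    generalize n * peq q (K n) (P n) (p n) = lam at hlam0 hlam2 ⊢
    refine add_le_add (add_le_add ?_ ?_) ?_
    · refine Real.exp_le_exp.2 ?_
      calc D * (lam * (C * (2 ^ (q + 1) * y)))
          ≤ D * (2 * L * (C * (2 ^ (q + 1) * Real.exp (-(1 / (2 * q) * L))))) := by
            gcongr
        _ = _ := by ring
    · calc y * Real.exp (D * (lam * (C * (2 ^ (q + 1) * y + (M / K n) ^ q))))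
          ≤ Real.exp (-(1 / (2 * q) * L)) * Real.exp (1 / (4 * q) * L) := by
            refine mul_le_mul hy1 (Real.exp_le_exp.2 ?_) (Real.exp_pos _).le (Real.exp_pos _).le
            calc _ ≤ D * (2 * L * (C * (2 ^ (q + 1) * y + (M / K n) ^ q))) := by
                  gcongr
              _ = 2 * D * (C * (2 ^ (q + 1) * y + (M / K n) ^ q)) * L := by ring
              _ ≤ _ := by gcongr
        _ = _ := by
            rw [← Real.exp_add]; congr 1; field_simp; ring
    · calc y ^ (M + 1) * Real.exp (D * lam)
          ≤ Real.exp (-(1 / (2 * q) * L)) ^ (M + 1) * Real.exp (D * (2 * L)) := by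
            gcongr
        _ ≤ _ := by
            rw [← Real.exp_nat_mul, ← Real.exp_add]
            refine Real.exp_le_exp.2 ?_
            push_cast
            have h7 : 2 * D + 1 ≤ (M + 1) * (1 / (2 * q)) := by
              rw [mul_one_div, le_div_iff₀ (by positivity)]
              linarith
            nlinarith [mul_le_mul_of_nonneg_right h7 hL0]

/-! ### Binomial and Poisson estimates -/

theorem le_choose_mul_pow_mul_pow {n h : ℕ} (hn : h + 1 ≤ n) {e : ℝ} (he0 : 0 ≤ e)
    (he : e ≤ 1 / 2) :
    (n * e) ^ h / h.factorial * Real.exp (-(n * e)) *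
        ((((n : ℝ) - h) / n) ^ h * Real.exp (-(2 * ((n * e) ^ 2 / n))))
      ≤ (n - 1).choose h * (e ^ h * (1 - e) ^ (n - 1 - h)) := by
  have hn0 : (0 : ℝ) < n := by exact_mod_cast (show 0 < n by omega)
  have hnh : (0 : ℝ) ≤ (n : ℝ) - h := by
    rw [sub_nonneg]; exact_mod_cast (show h ≤ n by omega)
  have h1 : ((n : ℝ) - h) ^ h / h.factorial ≤ (n - 1).choose h := by
    rw [div_le_iff₀ (by positivity), mul_comm]
    have h2 := Nat.pow_sub_le_descFactorial (n - 1) h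
    rw [Nat.descFactorial_eq_factorial_mul_choose, show n - 1 + 1 - h = n - h by omega] at h2
    have h3 : (((n - h : ℕ) : ℝ)) ^ h ≤ h.factorial * (n - 1).choose h := by exact_mod_cast h2
    rwa [Nat.cast_sub (by omega)] at h3
  have h4 : Real.exp (-(n * e)) * Real.exp (-(2 * ((n * e) ^ 2 / n))) ≤ (1 - e) ^ (n - 1 - h) := by
    have h5 : Real.exp (-(e + 2 * e ^ 2)) ≤ 1 - e := by
      have h6 : (0 : ℝ) < 1 - e := by linarith
      rw [← Real.le_log_iff_exp_le h6]
      refine le_trans ?_ (Real.one_sub_inv_le_log_of_pos h6)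
      have h7 : 1 - (1 - e)⁻¹ = -(e / (1 - e)) := by field_simp; ring
      rw [h7, neg_le_neg_iff, div_le_iff₀ h6]
      nlinarith [sq_nonneg e, mul_nonneg he0 he0]
    calc _ = Real.exp (-(e + 2 * e ^ 2)) ^ n := by
          rw [← Real.exp_add, ← Real.exp_nat_mul]; congr 1; field_simp; ring
      _ ≤ (1 - e) ^ n := pow_le_pow_left₀ (Real.exp_pos _).le h5 _
      _ ≤ _ := pow_le_pow_of_le_one (by linarith) (by linarith) (by omega)
  calc _ = (((n : ℝ) - h) ^ h / h.factorial) * (e ^ h *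
          (Real.exp (-(n * e)) * Real.exp (-(2 * ((n * e) ^ 2 / n))))) := by
        rw [mul_pow, div_pow]; field_simp
    _ ≤ _ := by gcongr

theorem choose_mul_pow_mul_pow_le {n d : ℕ} (hn : d + 1 ≤ n) {e : ℝ} (he0 : 0 ≤ e)
    (he : e ≤ 1) :
    (n - 1).choose d * (e ^ d * (1 - e) ^ (n - 1 - d))
      ≤ (n * e) ^ d * Real.exp (-(n * e)) * Real.exp (1 + d) := by
  have h1 : ((n - 1).choose d : ℝ) ≤ (n : ℝ) ^ d := by
    have h2 : (n - 1).choose d ≤ n ^ d :=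
      (Nat.choose_le_pow _ _).trans (Nat.pow_le_pow_left (Nat.sub_le _ _) _)
    exact_mod_cast h2
  have h3 : (1 - e) ^ (n - 1 - d) ≤ Real.exp (-(n * e)) * Real.exp (1 + d) := by
    calc _ ≤ Real.exp (-e) ^ (n - 1 - d) :=
          pow_le_pow_left₀ (by linarith) (Real.one_sub_le_exp_neg e) _
      _ ≤ _ := by
          rw [← Real.exp_nat_mul, ← Real.exp_add, Nat.sub_sub, Nat.cast_sub (by omega)]
          refine Real.exp_le_exp.2 ?_
          push_cast
          have : (0 : ℝ) ≤ d := Nat.cast_nonneg d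
          nlinarith
  calc _ ≤ (n : ℝ) ^ d * (e ^ d * (Real.exp (-(n * e)) * Real.exp (1 + d))) := by gcongr
    _ = _ := by rw [mul_pow]; ring

theorem tendsto_log_natCast : Tendsto (fun n : ℕ => Real.log (n : ℝ)) atTop atTop :=
  Real.tendsto_log_atTop.comp tendsto_natCast_atTop_atTop

theorem tendsto_log_log_natCast :
    Tendsto (fun n : ℕ => Real.log (Real.log (n : ℝ))) atTop atTop :=
  Real.tendsto_log_atTop.comp tendsto_log_natCast

theorem eventually_mul_log_log_le (a : ℝ) :
    ∀ᶠ n : ℕ in atTop, a * Real.log (Real.log n) ≤ Real.log n / 2 := by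
  have h := (Real.isLittleO_log_id_atTop.comp_tendsto tendsto_log_natCast).bound
    (show (0 : ℝ) < 1 / (2 * (|a| + 1)) by positivity)
  filter_upwards [h, tendsto_log_natCast.eventually_ge_atTop 0] with n hn h0
  simp only [Function.comp, id, Real.norm_eq_abs, abs_of_nonneg h0] at hn
  calc a * Real.log (Real.log n) ≤ |a * Real.log (Real.log n)| := le_abs_self _
    _ = |a| * |Real.log (Real.log n)| := abs_mul _ _
    _ ≤ (|a| + 1) * (1 / (2 * (|a| + 1)) * Real.log n) := by gcongr; linarith
    _ = _ := by field_simp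

theorem eventually_half_log_le {lam : ℕ → ℝ} {a₁ a₂ : ℝ}
    (h₁ : ∀ᶠ n : ℕ in atTop, Real.log n + a₁ * Real.log (Real.log n) ≤ lam n)
    (h₂ : ∀ᶠ n : ℕ in atTop, lam n ≤ Real.log n + a₂ * Real.log (Real.log n)) :
    ∀ᶠ n : ℕ in atTop, Real.log n / 2 ≤ lam n ∧ lam n ≤ 2 * Real.log n := by
  filter_upwards [h₁, h₂, eventually_mul_log_log_le (-a₁), eventually_mul_log_log_le a₂,
    tendsto_log_natCast.eventually_ge_atTop 0] with n h₁ h₂ h₃ h₄ h₀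
  constructor <;> linarith

theorem mul_exp_neg_eq {n : ℕ} (hn : 0 < n) (a : ℝ) :
    n * Real.exp (-(Real.log n + a * Real.log (Real.log n)))
      = Real.exp (-(a * Real.log (Real.log n))) := by
  have hn0 : (0 : ℝ) < n := by exact_mod_cast hn
  rw [neg_add, Real.exp_add, Real.exp_neg (Real.log n), Real.exp_log hn0, ← mul_assoc,
    mul_inv_cancel₀ hn0.ne', one_mul]

theorem tendsto_mul_poisson_atTop {lam : ℕ → ℝ} {h : ℕ} {a₁ a₂ : ℝ} (ha : a₂ < h)
    (h₁ : ∀ᶠ n : ℕ in atTop, Real.log n + a₁ * Real.log (Real.log n) ≤ lam n)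
    (h₂ : ∀ᶠ n : ℕ in atTop, lam n ≤ Real.log n + a₂ * Real.log (Real.log n)) :
    Tendsto (fun n : ℕ => n * (lam n ^ h / h.factorial * Real.exp (-lam n))) atTop atTop := by
  have hlim : Tendsto (fun n : ℕ => 1 / (2 ^ h * h.factorial) *
      Real.exp ((h - a₂) * Real.log (Real.log n))) atTop atTop :=
    (Real.tendsto_exp_atTop.comp
      (tendsto_log_log_natCast.const_mul_atTop (by linarith))).const_mul_atTop (by positivity)
  refine tendsto_atTop_mono' _ ?_ hlim
  filter_upwards [eventually_half_log_le h₁ h₂, h₂, eventually_gt_atTop 0,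
    tendsto_log_natCast.eventually_gt_atTop 0] with n h₃ h₂ hn hL
  have h4 : Real.exp (-(a₂ * Real.log (Real.log n))) ≤ n * Real.exp (-lam n) := by
    rw [← mul_exp_neg_eq hn]
    gcongr
  have h5 : Real.exp (h * Real.log (Real.log n)) = Real.log n ^ h := by
    rw [Real.exp_nat_mul, Real.exp_log hL]
  have h0 : 0 ≤ lam n := by linarith [h₃.1]
  have h6 : (Real.log n / 2) ^ h ≤ lam n ^ h := pow_le_pow_left₀ (by positivity) h₃.1 _
  calc _ = (Real.log n / 2) ^ h / h.factorial * Real.exp (-(a₂ * Real.log (Real.log n))) := by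
        rw [sub_mul, sub_eq_add_neg, Real.exp_add, h5, div_pow]; field_simp
    _ ≤ lam n ^ h / h.factorial * (n * Real.exp (-lam n)) := by gcongr
    _ = _ := by ring

theorem tendsto_mul_pow_mul_exp_neg_zero {lam : ℕ → ℝ} {d : ℕ} {a₁ a₂ : ℝ} (ha : d < a₁)
    (h₁ : ∀ᶠ n : ℕ in atTop, Real.log n + a₁ * Real.log (Real.log n) ≤ lam n)
    (h₂ : ∀ᶠ n : ℕ in atTop, lam n ≤ Real.log n + a₂ * Real.log (Real.log n)) :
    Tendsto (fun n : ℕ => n * (lam n ^ d * Real.exp (-lam n))) atTop (nhds 0) := by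
  have hlim : Tendsto (fun n : ℕ => 2 ^ d *
      Real.exp (-((a₁ - d) * Real.log (Real.log n)))) atTop (nhds 0) := by
    rw [← mul_zero ((2 : ℝ) ^ d)]
    exact (Real.tendsto_exp_neg_atTop_nhds_zero.comp
      (tendsto_log_log_natCast.const_mul_atTop (by linarith))).const_mul _
  refine squeeze_zero' ?_ ?_ hlim
  · filter_upwards [eventually_half_log_le h₁ h₂,
      tendsto_log_natCast.eventually_gt_atTop 0] with n h₃ hL
    have : 0 ≤ lam n := by linarith [h₃.1]
    positivity
  filter_upwards [eventually_half_log_le h₁ h₂, h₁, eventually_gt_atTop 0,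
    tendsto_log_natCast.eventually_gt_atTop 0] with n h₃ h₁ hn hL
  have h0 : 0 ≤ lam n := by linarith [h₃.1]
  have h4 : n * Real.exp (-lam n) ≤ Real.exp (-(a₁ * Real.log (Real.log n))) := by
    rw [← mul_exp_neg_eq hn]
    gcongr
  have h5 : Real.exp (d * Real.log (Real.log n)) = Real.log n ^ d := by
    rw [Real.exp_nat_mul, Real.exp_log hL]
  calc _ = lam n ^ d * (n * Real.exp (-lam n)) := by ring
    _ ≤ (2 * Real.log n) ^ d * Real.exp (-(a₁ * Real.log (Real.log n))) := by
        gcongr; exact h₃.2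
    _ = _ := by
        rw [sub_mul, neg_sub, sub_eq_add_neg, Real.exp_add, h5, mul_pow]; ring

/-! ### The minimum degree -/

theorem two_div_mul_sum_ind_degree_le {q n P h : ℕ} (hh : 1 ≤ h) (ω : Config n P)
    {m : ℝ} (hm : 0 < m) :
    2 / m * ∑ i, ind (degree q n P ω i = h)
      ≤ ind ((minDeg q n P ω : ℤ) = h ∨ (minDeg q n P ω : ℤ) = h - 1)
        + ((m ^ 2)⁻¹ * ∑ i, ∑ j, ind (degree q n P ω i = h ∧ degree q n P ω j = h)
        + ∑ d ∈ range (h - 1), ∑ i, ind (degree q n P ω i = d)) := by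
  have hsq : ∑ i, ∑ j, ind (degree q n P ω i = h ∧ degree q n P ω j = h)
      = (∑ i, ind (degree q n P ω i = h)) ^ 2 := by
    simp_rw [ind_and]
    rw [pow_two, sum_mul_sum]
  have hlow : 0 ≤ ∑ d ∈ range (h - 1), ∑ i, ind (degree q n P ω i = d) :=
    sum_nonneg fun d _ => sum_nonneg fun i _ => ind_nonneg _
  rw [hsq]
  have hamgm : ∀ x : ℝ, 2 / m * x ≤ 1 + (m ^ 2)⁻¹ * x ^ 2 := by
    intro x
    have h1 := sq_nonneg (1 - x / m)
    have h2 : (1 - x / m) ^ 2 = 1 + (m ^ 2)⁻¹ * x ^ 2 - 2 / m * x := by field_simp; ring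
    linarith
  by_cases hE : (minDeg q n P ω : ℤ) = h ∨ (minDeg q n P ω : ℤ) = h - 1
  · rw [ind_true hE]
    have := hamgm (∑ i, ind (degree q n P ω i = h))
    linarith
  by_cases hL : ∃ i, degree q n P ω i < h - 1
  · obtain ⟨i, hi⟩ := hL
    have h1 : 1 ≤ ∑ d ∈ range (h - 1), ∑ i, ind (degree q n P ω i = d) := by
      calc (1 : ℝ) = ind (degree q n P ω i = degree q n P ω i) := (ind_true rfl).symm
        _ ≤ ∑ j, ind (degree q n P ω j = degree q n P ω i) :=
            single_le_sum (f := fun j => ind (degree q n P ω j = degree q n P ω i))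
              (fun j _ => ind_nonneg _) (mem_univ i)
        _ ≤ _ := single_le_sum (f := fun d => ∑ j, ind (degree q n P ω j = d))
              (fun d _ => sum_nonneg fun j _ => ind_nonneg _) (Finset.mem_range.2 hi)
    have := hamgm (∑ i, ind (degree q n P ω i = h))
    have := ind_nonneg ((minDeg q n P ω : ℤ) = h ∨ (minDeg q n P ω : ℤ) = h - 1)
    linarith
  · push Not at hL
    have h0 : ∑ i, ind (degree q n P ω i = h) = 0 := by
      refine sum_eq_zero fun i _ => ind_false fun hi => hE ?_
      have h1 : minDeg q n P ω ≤ h := Nat.sInf_le ⟨i, hi⟩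
      have h2 : h - 1 ≤ minDeg q n P ω := by
        obtain ⟨j, hj⟩ : minDeg q n P ω ∈ Set.range fun i => degree q n P ω i :=
          Nat.sInf_mem ⟨_, i, rfl⟩
        rw [← hj]
        exact hL j
      omega
    rw [h0]
    have := ind_nonneg ((minDeg q n P ω : ℤ) = h ∨ (minDeg q n P ω : ℤ) = h - 1)
    rw [mul_zero, zero_pow two_ne_zero, mul_zero, zero_add]
    linarith

theorem prob_le_one {n K P : ℕ} (hKP : K ≤ P) {p : ℝ} (hp : p ∈ Set.Ioc (0 : ℝ) 1)
    (E : Set (Config n P)) : prob n K P p E ≤ 1 := by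
  rw [prob_eq_graphExpect]
  refine (graphExpect_mono hp (G := fun _ => 1) fun ω => ?_).trans_eq (graphExpect_one hKP p)
  exact Set.indicator_le_self' (fun _ _ => zero_le_one) ω

theorem le_prob_minDeg {q n K P h : ℕ} (hn : 0 < n) (hh : 1 ≤ h) (hqK : q ≤ K) (hKP : K ≤ P)
    {p : ℝ} (hp : p ∈ Set.Ioc (0 : ℝ) 1) {B P₁ : ℝ}
    (hP₁ : P₁ = (n - 1).choose h * (peq q K P p ^ h * (1 - peq q K P p) ^ (n - 1 - h)))
    (hpos : 0 < P₁) (hB0 : 0 ≤ B) (hB : ∀ i j : Fin n, i ≠ j →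
      graphExpect n K P p (fun ω => ind (degree q n P ω i = h ∧ degree q n P ω j = h)) ≤ B) :
    2 - (1 / (n * P₁) + B / P₁ ^ 2 + ∑ d ∈ range (h - 1), n * ((n - 1).choose d *
        (peq q K P p ^ d * (1 - peq q K P p) ^ (n - 1 - d))))
      ≤ prob n K P p {ω | (minDeg q n P ω : ℤ) = h ∨ (minDeg q n P ω : ℤ) = h - 1} := by
  have hn0 : (0 : ℝ) < n := by exact_mod_cast hn
  have hm : 0 < n * P₁ := by positivity
  have hle := graphExpect_mono (K := K) hp
    (fun ω : Config n P => two_div_mul_sum_ind_degree_le (q := q) hh ω hm)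
  have hprob : graphExpect n K P p
      (fun ω => ind ((minDeg q n P ω : ℤ) = h ∨ (minDeg q n P ω : ℤ) = h - 1))
      = prob n K P p {ω | (minDeg q n P ω : ℤ) = h ∨ (minDeg q n P ω : ℤ) = h - 1} := by
    rw [prob_eq_graphExpect]
    rfl
  rw [graphExpect_add, graphExpect_add, hprob, graphExpect_const_mul, graphExpect_const_mul,
    graphExpect_sum, graphExpect_sum, graphExpect_sum] at hle
  simp_rw [graphExpect_sum, graphExpect_degree hqK hKP, ← hP₁] at hle
  have hpair : ∑ i : Fin n, ∑ j : Fin n,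
      graphExpect n K P p (fun ω => ind (degree q n P ω i = h ∧ degree q n P ω j = h))
      ≤ n * P₁ + n ^ 2 * B := by
    calc _ ≤ ∑ i : Fin n, ∑ j : Fin n, ((if i = j then P₁ else 0) + B) := by
          refine sum_le_sum fun i _ => sum_le_sum fun j _ => ?_
          split_ifs with hij
          · subst hij
            simp only [and_self]
            rw [graphExpect_degree hqK hKP, ← hP₁]
            linarith
          · rw [zero_add]; exact hB i j hij
      _ = _ := by simp [sum_add_distrib]; ring
  simp only [sum_const, card_univ, Fintype.card_fin, nsmul_eq_mul] at hle
  have h1 : ((n * P₁) ^ 2)⁻¹ * ∑ i : Fin n, ∑ j : Fin n,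
      graphExpect n K P p (fun ω => ind (degree q n P ω i = h ∧ degree q n P ω j = h))
      ≤ 1 / (n * P₁) + B / P₁ ^ 2 := by
    calc _ ≤ ((n * P₁) ^ 2)⁻¹ * (n * P₁ + n ^ 2 * B) := by gcongr
      _ = _ := by field_simp
  have h2 : 2 / (n * P₁) * (n * P₁) = 2 := div_mul_cancel₀ _ hm.ne'
  linarith

theorem tendsto_prob_minDeg {q : ℕ} (hq : 1 ≤ q) {h : ℕ} (hh : 1 ≤ h) {K P : ℕ → ℕ}
    {p : ℕ → ℝ} {c₁ c₂ : ℝ} (hc₁ : -1 < c₁) (hc₂ : c₂ < 1)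
    (hK1 : ∀ n, 1 ≤ K n) (hKP : ∀ n, K n ≤ P n) (hp : ∀ n, p n ∈ Set.Ioc (0 : ℝ) 1)
    (hKinf : Tendsto (fun n => (K n : ℝ)) atTop atTop)
    (hKsqP : Tendsto (fun n => ((K n : ℝ)) ^ 2 / (P n : ℝ)) atTop (nhds 0))
    (h₁ : ∀ᶠ n : ℕ in atTop, Real.log n + (h - 1 + c₁) * Real.log (Real.log n)
      ≤ n * peq q (K n) (P n) (p n))
    (h₂ : ∀ᶠ n : ℕ in atTop, n * peq q (K n) (P n) (p n)
      ≤ Real.log n + (h - 1 + c₂) * Real.log (Real.log n)) :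
    Tendsto (fun n => prob n (K n) (P n) (p n)
      {ω | (minDeg q n (P n) ω : ℤ) = h ∨ (minDeg q n (P n) ω : ℤ) = h - 1}) atTop (nhds 1) := by
  set lam : ℕ → ℝ := fun n => n * peq q (K n) (P n) (p n) with hlam
  have hbd := eventually_half_log_le h₁ h₂
  have hlam_top : Tendsto lam atTop atTop :=
    tendsto_atTop_mono' _ (hbd.mono fun n hn => hn.1)
      (tendsto_log_natCast.atTop_div_const two_pos)
  have hinv : Tendsto (fun n : ℕ => (n : ℝ)⁻¹) atTop (nhds 0) := tendsto_inv_atTop_nhds_zero_nat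
  have hsq : Tendsto (fun n : ℕ => lam n ^ 2 / n) atTop (nhds 0) := by
    have hlim : Tendsto (fun n : ℕ => 4 * (Real.log n ^ 2 / n)) atTop (nhds 0) := by
      rw [← mul_zero (4 : ℝ)]
      have hl := (Real.isLittleO_pow_log_id_atTop (n := 2)).comp_tendsto
        tendsto_natCast_atTop_atTop
      exact hl.tendsto_div_nhds_zero.const_mul 4
    refine squeeze_zero' (Eventually.of_forall fun n => by positivity) ?_ hlim
    filter_upwards [hbd, tendsto_log_natCast.eventually_ge_atTop 0] with n hn h0
    have hl0 : 0 ≤ lam n := by linarith [hn.1]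
    calc lam n ^ 2 / n ≤ (2 * Real.log n) ^ 2 / n := by gcongr; exact hn.2
      _ = _ := by ring
  have hpeq : Tendsto (fun n => peq q (K n) (P n) (p n)) atTop (nhds 0) := by
    refine squeeze_zero' ?_ ?_ hsq
    · filter_upwards [hlam_top.eventually_ge_atTop 0, eventually_gt_atTop 0] with n hn hn0
      exact nonneg_of_mul_nonneg_right hn (by exact_mod_cast hn0)
    · filter_upwards [hlam_top.eventually_ge_atTop 1, eventually_gt_atTop 0] with n hn hn0
      have hn0' : (0 : ℝ) < n := by exact_mod_cast hn0
      rw [le_div_iff₀ hn0', mul_comm]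
      change lam n ≤ lam n ^ 2
      nlinarith
  set ρ : ℕ → ℝ := fun n => (((n : ℝ) - h) / n) ^ h * Real.exp (-(2 * (lam n ^ 2 / n))) with hρ
  have hρ1 : Tendsto ρ atTop (nhds 1) := by
    have ha : Tendsto (fun n : ℕ => ((n : ℝ) - h) / n) atTop (nhds 1) := by
      have := (hinv.const_mul (h : ℝ)).const_sub 1
      rw [mul_zero, sub_zero] at this
      refine this.congr' ?_
      filter_upwards [eventually_gt_atTop 0] with n hn
      have : (n : ℝ) ≠ 0 := by exact_mod_cast hn.ne'
      field_simp
    have := (ha.pow h).mul (hsq.const_mul 2).neg.rexp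
    simpa using this
  set μ : ℕ → ℝ := fun n => lam n ^ h / h.factorial * Real.exp (-lam n) with hμ
  have hμ_top : Tendsto (fun n : ℕ => n * μ n) atTop atTop :=
    tendsto_mul_poisson_atTop (by linarith) h₁ h₂
  have hlow : Tendsto (fun n : ℕ => ∑ d ∈ range (h - 1),
      n * (lam n ^ d * Real.exp (-lam n)) * Real.exp (1 + d)) atTop (nhds 0) := by
    rw [← sum_const_zero (s := range (h - 1))]
    refine tendsto_finsetSum _ fun d hd => ?_
    rw [← zero_mul (Real.exp (1 + d))]
    refine (tendsto_mul_pow_mul_exp_neg_zero ?_ h₁ h₂).mul_const _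
    have hd' : d + 2 ≤ h := by have := Finset.mem_range.1 hd; omega
    have : (d : ℝ) + 2 ≤ h := by exact_mod_cast hd'
    linarith
  refine tendsto_order.2 ⟨fun a ha => ?_, fun a ha => Eventually.of_forall fun n =>
    (prob_le_one (hKP n) (hp n) _).trans_lt ha⟩
  have hδ : 0 < (1 - a) / 2 := by linarith
  have hup : Tendsto (fun n : ℕ => 1 / (n * μ n * ρ n) +
      (1 + h ^ 2 / lam n ^ 2) * Real.exp (4 * peq q (K n) (P n) (p n) * (1 + h)) *
        (1 + (1 - a) / 2) / ρ n ^ 2 + ∑ d ∈ range (h - 1),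
      n * (lam n ^ d * Real.exp (-lam n)) * Real.exp (1 + d)) atTop (nhds (1 + (1 - a) / 2)) := by
    have t1 : Tendsto (fun n : ℕ => 1 / (n * μ n * ρ n)) atTop (nhds 0) :=
      (hμ_top.atTop_mul_pos one_pos hρ1).const_div_atTop 1
    have t2 : Tendsto (fun n : ℕ => 1 + h ^ 2 / lam n ^ 2) atTop (nhds 1) := by
      have := (((tendsto_pow_atTop two_ne_zero).comp hlam_top).const_div_atTop
        ((h : ℝ) ^ 2)).const_add 1
      rwa [add_zero] at this
    have t3 : Tendsto (fun n : ℕ => Real.exp (4 * peq q (K n) (P n) (p n) * (1 + h)))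
        atTop (nhds 1) := by
      have := ((hpeq.const_mul 4).mul_const (1 + (h : ℝ))).rexp
      rwa [mul_zero, zero_mul, Real.exp_zero] at this
    have := (t1.add (((t2.mul t3).mul_const (1 + (1 - a) / 2)).div (hρ1.pow 2)
      (by norm_num))).add hlow
    simpa using this
  have hOM := eventually_overlapMoment_le hq hK1 hKP hp hKinf hKsqP (D := 1 + 2 * h ^ 2)
    (by
      filter_upwards [hbd, hlam_top.eventually_ge_atTop 0] with n hn h0
      exact ⟨h0, hn.2⟩) (by positivity) hδ
  have hKq : ∀ᶠ n in atTop, q ≤ K n := by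
    filter_upwards [hKinf.eventually_ge_atTop (q : ℝ)] with n hn
    exact_mod_cast hn
  filter_upwards [hup.eventually_lt_const (show 1 + (1 - a) / 2 < 2 - a by linarith), hOM, hKq,
    hlam_top.eventually_ge_atTop 1, hpeq.eventually_le_const (show (0 : ℝ) < 1 / 2 by norm_num),
    eventually_ge_atTop (h + 4), hρ1.eventually_const_lt one_pos] with n hup hOM hKq hl1 he hn hρ0
  have hn0 : (0 : ℝ) < n := by exact_mod_cast (show 0 < n by omega)
  have he0 : 0 ≤ peq q (K n) (P n) (p n) :=
    nonneg_of_mul_nonneg_right (zero_le_one.trans hl1) hn0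
  have hμ0 : 0 < μ n := by
    have : 0 < lam n := by linarith
    simp only [hμ]
    positivity
  set P₁ : ℝ := (n - 1).choose h *
    (peq q (K n) (P n) (p n) ^ h * (1 - peq q (K n) (P n) (p n)) ^ (n - 1 - h)) with hP₁
  have hP₁le : μ n * ρ n ≤ P₁ := le_choose_mul_pow_mul_pow (by omega) he0 he
  have hP₁0 : 0 < P₁ := (mul_pos hμ0 hρ0).trans_le hP₁le
  have hs0 : 0 ≤ (1 + h ^ 2 / lam n ^ 2) *
      Real.exp (4 * peq q (K n) (P n) (p n) * (1 + h)) := by positivity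
  have hmain := le_prob_minDeg (q := q) (n := n) (h := h) (by omega) hh hKq (hKP n) (hp n) hP₁ hP₁0
    (B := μ n ^ 2 * ((1 + h ^ 2 / lam n ^ 2) *
      Real.exp (4 * peq q (K n) (P n) (p n) * (1 + h)) * (1 + (1 - a) / 2)))
    (by positivity) (fun i j hij =>
      (graphExpect_degree_degree_le hKq (hKP n) (hp n) (by omega) hl1 hij hh (by omega)).trans
        (by
          refine mul_le_mul_of_nonneg_left ?_ (sq_nonneg (μ n))
          exact mul_le_mul_of_nonneg_left hOM hs0))
  refine lt_of_lt_of_le ?_ hmain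
  have hb1 : 1 / (n * P₁) ≤ 1 / (n * μ n * ρ n) := by
    rw [mul_assoc]
    gcongr
  have hb2 : μ n ^ 2 * ((1 + h ^ 2 / lam n ^ 2) *
      Real.exp (4 * peq q (K n) (P n) (p n) * (1 + h)) * (1 + (1 - a) / 2)) / P₁ ^ 2
      ≤ (1 + h ^ 2 / lam n ^ 2) * Real.exp (4 * peq q (K n) (P n) (p n) * (1 + h)) *
        (1 + (1 - a) / 2) / ρ n ^ 2 := by
    rw [div_le_div_iff₀ (by positivity) (by positivity), mul_comm (μ n ^ 2), mul_assoc, ← mul_pow]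
    gcongr
  have hb3 : ∑ d ∈ range (h - 1), n * ((n - 1).choose d * (peq q (K n) (P n) (p n) ^ d *
      (1 - peq q (K n) (P n) (p n)) ^ (n - 1 - d)))
      ≤ ∑ d ∈ range (h - 1), n * (lam n ^ d * Real.exp (-lam n)) * Real.exp (1 + d) := by
    refine sum_le_sum fun d hd => ?_
    rw [mul_assoc]
    have := Finset.mem_range.1 hd
    exact mul_le_mul_of_nonneg_left
      (choose_mul_pow_mul_pow_le (by omega) he0 (by linarith)) hn0.le
  linarith

/-- under the fine-grained scaling
`p_{e,q}(n) = (ln n + (k−1) ln ln n + b ln ln n + β_n)/n` with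
`−1 < liminf β_n/ln ln n ≤ limsup β_n/ln ln n < 1` (i.e.,
`c₁ ln ln n ≤ β_n ≤ c₂ ln ln n` eventually, for constants `−1 < c₁ ≤ c₂ < 1`),
if `k + b ≥ 1` then the minimum degree of `𝔾_q(n,K_n,P_n,p_n)` equals
`k+b` or `k+b−1` with probability tending to `1`. -/
theorem min_degree_concentrates_on_two_values
    (q : ℕ) (hq : 1 ≤ q) (k : ℕ) (hk : 1 ≤ k) (b : ℤ)
    (K P : ℕ → ℕ) (p : ℕ → ℝ) (β : ℕ → ℝ)
    (c₁ c₂ : ℝ) (hc₁ : -1 < c₁) (hc₁₂ : c₁ ≤ c₂) (hc₂ : c₂ < 1)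
    (hK1 : ∀ n, 1 ≤ K n) (hKP : ∀ n, K n ≤ P n)
    (hp : ∀ n, p n ∈ Set.Ioc (0 : ℝ) 1)
    (hKinf : Tendsto (fun n => (K n : ℝ)) atTop atTop)
    (hKsqP : Tendsto (fun n => ((K n : ℝ)) ^ 2 / (P n : ℝ)) atTop (nhds 0))
    (hpe : ∀ n : ℕ, peq q (K n) (P n) (p n)
      = (Real.log (n : ℝ) + ((k : ℝ) - 1) * Real.log (Real.log (n : ℝ))
          + (b : ℝ) * Real.log (Real.log (n : ℝ)) + β n) / (n : ℝ))
    (hβbound : ∀ᶠ (n : ℕ) in atTop,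
      c₁ * Real.log (Real.log (n : ℝ)) ≤ β n ∧ β n ≤ c₂ * Real.log (Real.log (n : ℝ)))
    (hkb : 1 ≤ (k : ℤ) + b) :
    Tendsto (fun n => prob n (K n) (P n) (p n)
        {ω | (minDeg q n (P n) ω : ℤ) = (k : ℤ) + b ∨ (minDeg q n (P n) ω : ℤ) = (k : ℤ) + b - 1})
      atTop (nhds 1) := by
  obtain ⟨h, hh⟩ := Int.eq_ofNat_of_zero_le (show (0 : ℤ) ≤ k + b by omega)
  have hhR : (k : ℝ) + b = h := by exact_mod_cast hh
  have hlam : ∀ n : ℕ, 0 < n → n * peq q (K n) (P n) (p n)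
      = Real.log n + (h - 1) * Real.log (Real.log n) + β n := by
    intro n hn
    have hn0 : (n : ℝ) ≠ 0 := by exact_mod_cast hn.ne'
    rw [hpe, mul_div_cancel₀ _ hn0, ← hhR]
    ring
  rw [hh]
  refine tendsto_prob_minDeg hq (by omega) hc₁ hc₂ hK1 hKP hp hKinf hKsqP ?_ ?_
  · filter_upwards [hβbound, eventually_gt_atTop 0] with n hβ hn
    rw [hlam n hn]
    linarith [hβ.1]
  · filter_upwards [hβbound, eventually_gt_atTop 0] with n hβ hn
    rw [hlam n hn]
    linarith [hβ.2]
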